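/- arXiv:2109.06413 — 2 statements merged into one kernel-verified Lean document; each statement's English description precedes it below -/
import Mathlib

section
/- Let A and B be dg algebras over a field k of characteristic zero, let X be a dg A-B-bimodule, let π_A: Hoch_⊕^•(X) ↠ Hoch_⊕^•(A) and π_B: Hoch_⊕^•(X) ↠ Hoch_⊕^•(B) be the natural projections, and let ι_A: Hoch_⊕^•(A) ↪ Hoch_⊕^•(X) and ι_B: Hoch_⊕^•(B) ↪ Hoch_⊕^•(X) be the natural inclusions. Then: (i) π_A and π_B are cochain maps with respect to the differential d_H + ∂; (ii) π_A, π_B, ι_A, ι_B respect the i-th compositions ∘_i and hence preserve the Gerstenhaber brackets; (iii) π_A, π_B, ι_A, ι_B preserve the cup products. -/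
set_option maxHeartbeats 1000000
set_option synthInstance.maxHeartbeats 400000
set_option linter.unusedVariables false

noncomputable section

namespace KD

open scoped BigOperators TensorProduct

variable (k : Type) [Field k]

def ε (n : ℤ) : k := if Even n then 1 else -1

def ext0 {X : Type} [Zero X] {n : ℕ} (a : Fin n → X) (m : ℕ) : X :=
  if h : m < n then a ⟨m, h⟩ else 0

def compAtF {X : Type} [Zero X] (p₁ p₂ : ℤ)
    (f : (Fin p₁.toNat → X) → X) (g : (Fin p₂.toNat → X) → X)
    (i : ℕ) (a : Fin (p₁ + p₂ - 1).toNat → X) : X :=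
  f (fun j => if (j : ℕ) < i then ext0 a (j : ℕ)
      else if (j : ℕ) = i then g (fun l => ext0 a (i + (l : ℕ)))
      else ext0 a ((j : ℕ) + p₂.toNat - 1))

structure DGAlgebra (A : Type) [Ring A] [Algebra k A] : Type where
  gr : ℤ → Submodule k A
  one_mem : (1 : A) ∈ gr 0
  mul_mem : ∀ {i j : ℤ} {a b : A}, a ∈ gr i → b ∈ gr j → a * b ∈ gr (i + j)
  isInternal : DirectSum.IsInternal gr
  d : A →ₗ[k] A
  d_sq : ∀ a, d (d a) = 0
  d_mem : ∀ {i : ℤ} {a : A}, a ∈ gr i → d a ∈ gr (i + 1)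
  d_leibniz : ∀ {i : ℤ} (a b : A), a ∈ gr i → d (a * b) = d a * b + ε k i • (a * d b)

variable {A : Type} [Ring A] [Algebra k A]

abbrev Coch (A : Type) [Ring A] [Algebra k A] (p : ℤ) : Type :=
  MultilinearMap k (fun _ : Fin p.toNat => A) A

def cochCast {p q : ℤ} (h : p = q) (f : Coch k A p) : Coch k A q :=
  f.domDomCongr (finCongr (congrArg Int.toNat h))

def IsHomog (R : DGAlgebra k A) (p r : ℤ) (f : Coch k A p) : Prop :=
  ∀ (dg : ℕ → ℤ) (a : ℕ → A), (∀ i, a i ∈ R.gr (dg i)) →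
    f (fun i => a (i : ℕ)) ∈ R.gr ((∑ i : Fin p.toNat, dg (i : ℕ)) + r)

/-- The family `dH` is the Hochschild differential of `(A, d_A)`. -/
def IsHochDiff (R : DGAlgebra k A)
    (dH : ∀ p r : ℤ, Coch k A p →ₗ[k] Coch k A (p + 1)) : Prop :=
  ∀ (p : ℤ), 0 ≤ p → ∀ (r : ℤ) (f : Coch k A p) (dg : ℕ → ℤ) (a : ℕ → A),
    (∀ i, a i ∈ R.gr (dg i)) →
    dH p r f (fun i => a (i : ℕ)) =
      ε k (p + r - 1 + r * dg 0) • (a 0 * f (fun i => a ((i : ℕ) + 1)))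
      + ∑ i : Fin p.toNat, ε k (p + r + (i : ℕ)) •
          f (fun j => if (j : ℕ) < (i : ℕ) then a (j : ℕ)
              else if (j : ℕ) = (i : ℕ) then a (i : ℕ) * a ((i : ℕ) + 1)
              else a ((j : ℕ) + 1))
      + ε k r • (f (fun i => a (i : ℕ)) * a p.toNat)

/-- The family `pd` is the internal differential `∂` induced by `d_A`. -/
def IsIntDiff (R : DGAlgebra k A)
    (pd : ∀ p r : ℤ, Coch k A p →ₗ[k] Coch k A p) : Prop :=
  ∀ (p : ℤ), 0 ≤ p → ∀ (r : ℤ) (f : Coch k A p) (dg : ℕ → ℤ) (a : ℕ → A),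
    (∀ i, a i ∈ R.gr (dg i)) →
    pd p r f (fun i => a (i : ℕ)) =
      R.d (f (fun i => a (i : ℕ)))
      - ε k r • ∑ i : Fin p.toNat,
          ε k (∑ j ∈ Finset.range (i : ℕ), dg j) •
            f (fun j => if (j : ℕ) = (i : ℕ) then R.d (a (i : ℕ)) else a (j : ℕ))

/-- The family `cup` is the cup product of Hochschild cochains. -/
def IsCup (R : DGAlgebra k A)
    (cup : ∀ p₁ r₁ p₂ r₂ : ℤ, Coch k A p₁ →ₗ[k] Coch k A p₂ →ₗ[k] Coch k A (p₁ + p₂)) : Prop :=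
  ∀ (p₁ : ℤ), 0 ≤ p₁ → ∀ (p₂ : ℤ), 0 ≤ p₂ → ∀ (r₁ r₂ : ℤ)
    (f : Coch k A p₁) (g : Coch k A p₂) (dg : ℕ → ℤ) (a : ℕ → A),
    (∀ i, a i ∈ R.gr (dg i)) →
    cup p₁ r₁ p₂ r₂ f g (fun i => a (i : ℕ)) =
      ε k (p₁ * p₂ + r₂ * ((∑ j ∈ Finset.range p₁.toNat, dg j) + p₁)) •
        (f (fun i => a (i : ℕ)) * g (fun j => a (p₁.toNat + (j : ℕ))))

/-- The family `br` is the Gerstenhaber bracket of Hochschild cochains. -/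
def IsBracket
    (br : ∀ p₁ r₁ p₂ r₂ : ℤ, Coch k A p₁ →ₗ[k] Coch k A p₂ →ₗ[k] Coch k A (p₁ + p₂ - 1)) : Prop :=
  ∀ (p₁ r₁ p₂ r₂ : ℤ) (f : Coch k A p₁) (g : Coch k A p₂)
    (a : Fin (p₁ + p₂ - 1).toNat → A),
    br p₁ r₁ p₂ r₂ f g a =
      (∑ i : Fin p₁.toNat,
        ε k ((p₁ - 1) * r₂ + (i : ℕ) * (p₂ - 1)) • compAtF p₁ p₂ ⇑f ⇑g (i : ℕ) a)
      - ε k ((p₁ + r₁ - 1) * (p₂ + r₂ - 1)) •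
        ∑ j : Fin p₂.toNat,
          ε k ((p₂ - 1) * r₁ + (j : ℕ) * (p₁ - 1)) •
            compAtF p₂ p₁ ⇑g ⇑f (j : ℕ) (fun m => a (Fin.cast (by omega) m))

/- Total (sum) Hochschild complex -/

abbrev TotCoch (A : Type) [Ring A] [Algebra k A] : Type := ∀ p : ℕ, Coch k A (p : ℤ)

def TotHomog (R : DGAlgebra k A) (n : ℤ) (c : TotCoch k A) : Prop :=
  ∀ p : ℕ, IsHomog k R p (n - p) (c p)

def TotFinSupp (c : TotCoch k A) : Prop := ∃ N : ℕ, ∀ p ≥ N, c p = 0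

/-- The total differential `d_H + ∂` on the sum Hochschild complex,
applied to a total cochain of total degree `n`. -/
def TotD (dH : ∀ p r : ℤ, Coch k A p →ₗ[k] Coch k A (p + 1))
    (pd : ∀ p r : ℤ, Coch k A p →ₗ[k] Coch k A p)
    (n : ℤ) (c : TotCoch k A) : TotCoch k A :=
  fun p => match p with
  | 0 => pd 0 n (c 0)
  | (q+1) => pd ((q : ℤ) + 1) (n - ((q : ℤ) + 1)) (c (q + 1)) + dH (q : ℤ) (n - q) (c q)

def TotIsCocycle (dH : ∀ p r : ℤ, Coch k A p →ₗ[k] Coch k A (p + 1))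
    (pd : ∀ p r : ℤ, Coch k A p →ₗ[k] Coch k A p)
    (n : ℤ) (c : TotCoch k A) : Prop :=
  ∀ p : ℕ, TotD k dH pd n c p = 0

def TotIsCoboundary (R : DGAlgebra k A)
    (dH : ∀ p r : ℤ, Coch k A p →ₗ[k] Coch k A (p + 1))
    (pd : ∀ p r : ℤ, Coch k A p →ₗ[k] Coch k A p)
    (n : ℤ) (c : TotCoch k A) : Prop :=
  ∃ b : TotCoch k A, TotHomog k R (n - 1) b ∧ TotFinSupp k b ∧
    ∀ p : ℕ, c p = TotD k dH pd (n - 1) b p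

/-- Total cup product of total cochains of total degrees `n₁`, `n₂`. -/
def totCup (cup : ∀ p₁ r₁ p₂ r₂ : ℤ, Coch k A p₁ →ₗ[k] Coch k A p₂ →ₗ[k] Coch k A (p₁ + p₂))
    (n₁ n₂ : ℤ) (c c' : TotCoch k A) : TotCoch k A :=
  fun p => ∑ x ∈ (Finset.range (p + 1)).attach,
    cochCast k (by have := Finset.mem_range.mp x.2; omega)
      (cup (x.1 : ℤ) (n₁ - x.1) ((p - x.1 : ℕ) : ℤ) (n₂ - ((p - x.1 : ℕ) : ℤ))
        (c x.1) (c' (p - x.1)))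

/-- Total Gerstenhaber bracket of total cochains of total degrees `n₁`, `n₂`. -/
def totBr (br : ∀ p₁ r₁ p₂ r₂ : ℤ, Coch k A p₁ →ₗ[k] Coch k A p₂ →ₗ[k] Coch k A (p₁ + p₂ - 1))
    (n₁ n₂ : ℤ) (c c' : TotCoch k A) : TotCoch k A :=
  fun p => ∑ x ∈ (Finset.range (p + 2)).attach,
    cochCast k (by have := Finset.mem_range.mp x.2; omega)
      (br (x.1 : ℤ) (n₁ - x.1) ((p + 1 - x.1 : ℕ) : ℤ) (n₂ - ((p + 1 - x.1 : ℕ) : ℤ))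
        (c x.1) (c' (p + 1 - x.1)))

/- ## Differential graded bimodules and Hochschild cochains with coefficients -/

variable {M : Type} [AddCommGroup M] [Module k M]

/-- A dg `A`-`A`-bimodule structure on `M` over a dg algebra `(A, R)`. -/
structure DGBimod (R : DGAlgebra k A) (M : Type) [AddCommGroup M] [Module k M] : Type where
  gr : ℤ → Submodule k M
  isInternal : DirectSum.IsInternal gr
  actL : A →ₗ[k] M →ₗ[k] M
  actR : A →ₗ[k] M →ₗ[k] M
  actL_one : ∀ m, actL 1 m = m
  actL_mul : ∀ a b m, actL (a * b) m = actL a (actL b m)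
  actR_one : ∀ m, actR 1 m = m
  actR_mul : ∀ a b m, actR (a * b) m = actR b (actR a m)
  actLR : ∀ a b m, actR b (actL a m) = actL a (actR b m)
  actL_mem : ∀ {i j : ℤ} {a : A} {m : M}, a ∈ R.gr i → m ∈ gr j → actL a m ∈ gr (i + j)
  actR_mem : ∀ {i j : ℤ} {a : A} {m : M}, a ∈ R.gr i → m ∈ gr j → actR a m ∈ gr (j + i)
  dM : M →ₗ[k] M
  dM_sq : ∀ m, dM (dM m) = 0
  dM_mem : ∀ {j : ℤ} {m : M}, m ∈ gr j → dM m ∈ gr (j + 1)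
  dM_actL : ∀ {i : ℤ} (a : A) (m : M), a ∈ R.gr i →
    dM (actL a m) = actL (R.d a) m + ε k i • actL a (dM m)
  dM_actR : ∀ {j : ℤ} (a : A) (m : M), m ∈ gr j →
    dM (actR a m) = actR a (dM m) + ε k j • actR (R.d a) m

/-- A dg algebra is a dg bimodule over itself. -/
def DGAlgebra.toBimod (R : DGAlgebra k A) : DGBimod k R A where
  gr := R.gr
  isInternal := R.isInternal
  actL := LinearMap.mul k A
  actR := (LinearMap.mul k A).flip
  actL_one := fun m => one_mul m
  actL_mul := fun a b m => mul_assoc a b m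
  actR_one := fun m => mul_one m
  actR_mul := fun a b m => (mul_assoc m a b).symm
  actLR := fun a b m => mul_assoc a m b
  actL_mem := fun ha hm => R.mul_mem ha hm
  actR_mem := fun ha hm => R.mul_mem hm ha
  dM := R.d
  dM_sq := R.d_sq
  dM_mem := R.d_mem
  dM_actL := fun a m ha => R.d_leibniz a m ha
  dM_actR := fun a m hm => R.d_leibniz m a hm

/-- Hochschild `p`-cochains of `A` with values in `M`. -/
abbrev MCoch (A M : Type) [Ring A] [Algebra k A] [AddCommGroup M] [Module k M]
    (p : ℕ) : Type :=
  MultilinearMap k (fun _ : Fin p => A) M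

variable {R : DGAlgebra k A}

/-- `f` is an `M`-valued Hochschild cochain of bidegree `(p, r)`. -/
def IsHomogM (St : DGBimod k R M) (p : ℕ) (r : ℤ) (f : MCoch k A M p) : Prop :=
  ∀ (dg : ℕ → ℤ) (a : ℕ → A), (∀ i, a i ∈ R.gr (dg i)) →
    f (fun i => a (i : ℕ)) ∈ St.gr ((∑ i : Fin p, dg (i : ℕ)) + r)

/-- The family `dHM` is the Hochschild differential with values in the
dg bimodule `M`. -/
def IsHochDiffM (St : DGBimod k R M)
    (dHM : ∀ (p : ℕ) (r : ℤ), MCoch k A M p →ₗ[k] MCoch k A M (p + 1)) : Prop :=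
  ∀ (p : ℕ) (r : ℤ) (f : MCoch k A M p) (dg : ℕ → ℤ) (a : ℕ → A),
    (∀ i, a i ∈ R.gr (dg i)) →
    dHM p r f (fun i => a (i : ℕ)) =
      ε k ((p : ℤ) + r - 1 + r * dg 0) • St.actL (a 0) (f (fun i => a ((i : ℕ) + 1)))
      + ∑ i : Fin p, ε k ((p : ℤ) + r + (i : ℕ)) •
          f (fun j => if (j : ℕ) < (i : ℕ) then a (j : ℕ)
              else if (j : ℕ) = (i : ℕ) then a (i : ℕ) * a ((i : ℕ) + 1)
              else a ((j : ℕ) + 1))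
      + ε k r • St.actR (a p) (f (fun i => a (i : ℕ)))

/-- The family `pdM` is the internal differential `∂` induced by `d_A` and `d_M`. -/
def IsIntDiffM (St : DGBimod k R M)
    (pdM : ∀ (p : ℕ) (r : ℤ), MCoch k A M p →ₗ[k] MCoch k A M p) : Prop :=
  ∀ (p : ℕ) (r : ℤ) (f : MCoch k A M p) (dg : ℕ → ℤ) (a : ℕ → A),
    (∀ i, a i ∈ R.gr (dg i)) →
    pdM p r f (fun i => a (i : ℕ)) =
      St.dM (f (fun i => a (i : ℕ)))
      - ε k r • ∑ i : Fin p,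
          ε k (∑ j ∈ Finset.range (i : ℕ), dg j) •
            f (fun j => if (j : ℕ) = (i : ℕ) then R.d (a (i : ℕ)) else a (j : ℕ))

/-- Recasting an `M`-valued cochain along an equality of arities. -/
def mcochCast {p q : ℕ} (h : p = q) (f : MCoch k A M p) : MCoch k A M q :=
  f.domDomCongr (finCongr h)

/-- Post-composition `H = h∘(−)` on `M`-valued cochains. -/
def Hop (h : M →ₗ[k] M) {p : ℕ} (f : MCoch k A M p) : MCoch k A M p :=
  h.compMultilinearMap f

/-- The operators `𝔥_j = (H ∘ d_H)^j ∘ H` applied to cochains of bidegree `(p,r)`. -/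
def frakh (dHM : ∀ (p : ℕ) (r : ℤ), MCoch k A M p →ₗ[k] MCoch k A M (p + 1))
    (h : M →ₗ[k] M) (p : ℕ) (r : ℤ) : (j : ℕ) → MCoch k A M p → MCoch k A M (p + j)
  | 0, f => Hop k h f
  | (j + 1), f => Hop k h (dHM (p + j) (r - j - 1) (frakh dHM h p r j f))

/-- `h` is a contracting homotopy for the dg bimodule `M` (a degree `-1` map
with `d_M ∘ h + h ∘ d_M = id`). -/
def IsContracting (St : DGBimod k R M) (h : M →ₗ[k] M) : Prop :=
  (∀ m, St.dM (h m) + h (St.dM m) = m) ∧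
  ∀ {j : ℤ} {m : M}, m ∈ St.gr j → h m ∈ St.gr (j - 1)

/-- The acyclic dg bimodule `M` is pointwisely nilpotent: some contracting
homotopy `h` satisfies that for every Hochschild cochain `f` with values in `M`
there is `N` with `𝔥_j f = 0` for all `j > N`. -/
def PointwiseNilpotent (St : DGBimod k R M)
    (dHM : ∀ (p : ℕ) (r : ℤ), MCoch k A M p →ₗ[k] MCoch k A M (p + 1)) : Prop :=
  ∃ h : M →ₗ[k] M, IsContracting k St h ∧
    ∀ (p : ℕ) (r : ℤ) (f : MCoch k A M p), IsHomogM k St p r f →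
      ∃ N : ℕ, ∀ j : ℕ, j > N → frakh k dHM h p r j f = 0

/- Total complex with values in `M` -/

abbrev TotMCoch (A M : Type) [Ring A] [Algebra k A] [AddCommGroup M] [Module k M] : Type :=
  ∀ p : ℕ, MCoch k A M p

def TotHomogM (St : DGBimod k R M) (n : ℤ) (c : TotMCoch k A M) : Prop :=
  ∀ p : ℕ, IsHomogM k St p (n - p) (c p)

def TotFinSuppM (c : TotMCoch k A M) : Prop := ∃ N : ℕ, ∀ p ≥ N, c p = 0

def TotDM (dHM : ∀ (p : ℕ) (r : ℤ), MCoch k A M p →ₗ[k] MCoch k A M (p + 1))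
    (pdM : ∀ (p : ℕ) (r : ℤ), MCoch k A M p →ₗ[k] MCoch k A M p)
    (n : ℤ) (c : TotMCoch k A M) : TotMCoch k A M :=
  fun p => match p with
  | 0 => pdM 0 n (c 0)
  | (q + 1) => pdM (q + 1) (n - ((q : ℤ) + 1)) (c (q + 1)) + dHM q (n - q) (c q)

def TotIsCocycleM (dHM : ∀ (p : ℕ) (r : ℤ), MCoch k A M p →ₗ[k] MCoch k A M (p + 1))
    (pdM : ∀ (p : ℕ) (r : ℤ), MCoch k A M p →ₗ[k] MCoch k A M p)
    (n : ℤ) (c : TotMCoch k A M) : Prop :=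
  ∀ p : ℕ, TotDM k dHM pdM n c p = 0

def TotIsCoboundaryM (St : DGBimod k R M)
    (dHM : ∀ (p : ℕ) (r : ℤ), MCoch k A M p →ₗ[k] MCoch k A M (p + 1))
    (pdM : ∀ (p : ℕ) (r : ℤ), MCoch k A M p →ₗ[k] MCoch k A M p)
    (n : ℤ) (c : TotMCoch k A M) : Prop :=
  ∃ b : TotMCoch k A M, TotHomogM k St (n - 1) b ∧ TotFinSuppM k b ∧
    ∀ p : ℕ, c p = TotDM k dHM pdM (n - 1) b p

/- Morphisms of dg bimodules, quasi-isomorphisms, mapping cones -/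

variable {N : Type} [AddCommGroup N] [Module k N]

/-- Morphism of dg `A`-`A`-bimodules (degree-preserving, chain map, bilinear). -/
def IsBimodHom (StM : DGBimod k R M) (StN : DGBimod k R N) (φ : M →ₗ[k] N) : Prop :=
  (∀ (i : ℤ) (m : M), m ∈ StM.gr i → φ m ∈ StN.gr i)
  ∧ (∀ m, φ (StM.dM m) = StN.dM (φ m))
  ∧ (∀ a m, φ (StM.actL a m) = StN.actL a (φ m))
  ∧ (∀ a m, φ (StM.actR a m) = StN.actR a (φ m))

/-- `φ` is a quasi-isomorphism of dg bimodules (bijective on cohomology). -/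
def IsQuasiIso (StM : DGBimod k R M) (StN : DGBimod k R N) (φ : M →ₗ[k] N) : Prop :=
  (∀ (i : ℤ) (n : N), n ∈ StN.gr i → StN.dM n = 0 →
    ∃ m ∈ StM.gr i, StM.dM m = 0 ∧ ∃ n' ∈ StN.gr (i - 1), φ m - n = StN.dM n')
  ∧ (∀ (i : ℤ) (m : M), m ∈ StM.gr i → StM.dM m = 0 →
    (∃ n' ∈ StN.gr (i - 1), φ m = StN.dM n') →
    ∃ m' ∈ StM.gr (i - 1), m = StM.dM m')

/-- `(C, SC, inM, inN)` is a model for the mapping cone `Cone(φ) = M[1] ⊕ N`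
as a dg `A`-`A`-bimodule. -/
def IsConeModel (StM : DGBimod k R M) (StN : DGBimod k R N) (φ : M →ₗ[k] N)
    {C : Type} [AddCommGroup C] [Module k C] (SC : DGBimod k R C)
    (inM : M →ₗ[k] C) (inN : N →ₗ[k] C) : Prop :=
  Function.Bijective (fun mn : M × N => inM mn.1 + inN mn.2)
  ∧ (∀ m, SC.dM (inM m) = - inM (StM.dM m) + inN (φ m))
  ∧ (∀ n, SC.dM (inN n) = inN (StN.dM n))
  ∧ (∀ (i : ℤ) (m : M), m ∈ StM.gr (i + 1) → inM m ∈ SC.gr i)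
  ∧ (∀ (i : ℤ) (n : N), n ∈ StN.gr i → inN n ∈ SC.gr i)
  ∧ (∀ (i : ℤ) (c : C), c ∈ SC.gr i → ∃ m ∈ StM.gr (i + 1), ∃ n ∈ StN.gr i,
      c = inM m + inN n)
  ∧ (∀ (i : ℤ) (a : A) (m : M), a ∈ R.gr i →
      SC.actL a (inM m) = ε k i • inM (StM.actL a m))
  ∧ (∀ (a : A) (n : N), SC.actL a (inN n) = inN (StN.actL a n))
  ∧ (∀ (a : A) (m : M), SC.actR a (inM m) = inM (StM.actR a m))
  ∧ (∀ (a : A) (n : N), SC.actR a (inN n) = inN (StN.actR a n))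

/-- A bundled model of the mapping cone of `φ`. -/
structure ConeData (StM : DGBimod k R M) (StN : DGBimod k R N) (φ : M →ₗ[k] N) where
  C : Type
  [instAdd : AddCommGroup C]
  [instMod : Module k C]
  SC : DGBimod k R C
  inM : M →ₗ[k] C
  inN : N →ₗ[k] C
  isCone : IsConeModel k StM StN φ SC inM inN

attribute [instance] ConeData.instAdd ConeData.instMod

/-- The mapping cone of `φ` is pointwisely nilpotent. -/
def ConePN (StM : DGBimod k R M) (StN : DGBimod k R N) (φ : M →ₗ[k] N) : Prop :=
  ∃ D : ConeData k StM StN φ,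
    ∃ dHC : ∀ (p : ℕ) (r : ℤ), MCoch k A D.C p →ₗ[k] MCoch k A D.C (p + 1),
      IsHochDiffM k D.SC dHC ∧ PointwiseNilpotent k D.SC dHC

/-- `φ` is weakly cone-nilpotent: its mapping cone is pointwisely nilpotent, or
it admits a right (resp. left) inverse morphism of dg bimodules whose mapping
cone is pointwisely nilpotent. -/
def WeaklyConeNilpotent (StM : DGBimod k R M) (StN : DGBimod k R N) (φ : M →ₗ[k] N) : Prop :=
  ConePN k StM StN φ
  ∨ (∃ ψ : N →ₗ[k] M, IsBimodHom k StN StM ψ ∧ (∀ n, φ (ψ n) = n) ∧ ConePN k StN StM ψ)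
  ∨ (∃ ψ : N →ₗ[k] M, IsBimodHom k StN StM ψ ∧ (∀ m, ψ (φ m) = m) ∧ ConePN k StN StM ψ)
/- ## Pairs of dg algebras and dg `A`-`B`-bimodules -/

variable {B : Type} [Ring B] [Algebra k B]
variable {X : Type} [AddCommGroup X] [Module k X]

/-- A dg `A`-`B`-bimodule structure on `X`. -/
structure ABBimod (RA : DGAlgebra k A) (RB : DGAlgebra k B)
    (X : Type) [AddCommGroup X] [Module k X] : Type where
  gr : ℤ → Submodule k X
  isInternal : DirectSum.IsInternal gr
  actL : A →ₗ[k] X →ₗ[k] X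
  actR : B →ₗ[k] X →ₗ[k] X
  actL_one : ∀ x, actL 1 x = x
  actL_mul : ∀ a a' x, actL (a * a') x = actL a (actL a' x)
  actR_one : ∀ x, actR 1 x = x
  actR_mul : ∀ b b' x, actR (b * b') x = actR b' (actR b x)
  actLR : ∀ a b x, actR b (actL a x) = actL a (actR b x)
  actL_mem : ∀ {i j : ℤ} {a : A} {x : X}, a ∈ RA.gr i → x ∈ gr j → actL a x ∈ gr (i + j)
  actR_mem : ∀ {i j : ℤ} {b : B} {x : X}, b ∈ RB.gr i → x ∈ gr j → actR b x ∈ gr (j + i)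
  dX : X →ₗ[k] X
  dX_sq : ∀ x, dX (dX x) = 0
  dX_mem : ∀ {j : ℤ} {x : X}, x ∈ gr j → dX x ∈ gr (j + 1)
  dX_actL : ∀ {i : ℤ} (a : A) (x : X), a ∈ RA.gr i →
    dX (actL a x) = actL (RA.d a) x + ε k i • actL a (dX x)
  dX_actR : ∀ {j : ℤ} (b : B) (x : X), x ∈ gr j →
    dX (actR b x) = actR b (dX x) + ε k j • actR (RB.d b) x

/-- Hochschild cochains of type `Hom(A^{⊗p} ⊗ X ⊗ B^{⊗q}, X)`, in curried form. -/
abbrev XCoch (A B X : Type) [Ring A] [Algebra k A] [Ring B] [Algebra k B]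
    [AddCommGroup X] [Module k X] (p q : ℕ) : Type :=
  MultilinearMap k (fun _ : Fin p => A)
    (X →ₗ[k] MultilinearMap k (fun _ : Fin q => B) X)

variable {RA : DGAlgebra k A} {RB : DGAlgebra k B}

/-- `f ∈ Hoch^{p,q,r}(A,X,B)`: homogeneity of internal degree `r`. -/
def IsHomogX (SX : ABBimod k RA RB X) (p q : ℕ) (r : ℤ) (f : XCoch k A B X p q) : Prop :=
  ∀ (dga : ℕ → ℤ) (a : ℕ → A), (∀ i, a i ∈ RA.gr (dga i)) →
  ∀ (ix : ℤ) (x : X), x ∈ SX.gr ix →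
  ∀ (dgb : ℕ → ℤ) (b : ℕ → B), (∀ j, b j ∈ RB.gr (dgb j)) →
    f (fun i => a (i : ℕ)) x (fun j => b (j : ℕ))
      ∈ SX.gr ((∑ i : Fin p, dga (i : ℕ)) + ix + (∑ j : Fin q, dgb (j : ℕ)) + r)

/-- `dXL` is the left part `(d_H^X)_L` of the Hochschild differential of the
dg `A`-`B`-bimodule `X`. -/
def IsDXL (SX : ABBimod k RA RB X)
    (dXL : ∀ (p q : ℕ) (r : ℤ), XCoch k A B X p q →ₗ[k] XCoch k A B X (p + 1) q) : Prop :=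
  ∀ (p q : ℕ) (r : ℤ) (f : XCoch k A B X p q)
    (dga : ℕ → ℤ) (a : ℕ → A), (∀ i, a i ∈ RA.gr (dga i)) →
    ∀ (x : X) (b : ℕ → B),
    dXL p q r f (fun i => a (i : ℕ)) x (fun j => b (j : ℕ)) =
      ε k ((p : ℤ) + q + r + r * dga 0) •
        SX.actL (a 0) (f (fun i => a ((i : ℕ) + 1)) x (fun j => b (j : ℕ)))
      + ∑ i : Fin p, ε k ((p : ℤ) + q + r + (i : ℕ) + 1) •
          f (fun j => if (j : ℕ) < (i : ℕ) then a (j : ℕ)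
              else if (j : ℕ) = (i : ℕ) then a (i : ℕ) * a ((i : ℕ) + 1)
              else a ((j : ℕ) + 1)) x (fun j => b (j : ℕ))
      + ε k ((q : ℤ) + r + 1) •
          f (fun i => a (i : ℕ)) (SX.actL (a p) x) (fun j => b (j : ℕ))

/-- `dXR` is the right part `(d_H^X)_R` of the Hochschild differential of `X`. -/
def IsDXR (SX : ABBimod k RA RB X)
    (dXR : ∀ (p q : ℕ) (r : ℤ), XCoch k A B X p q →ₗ[k] XCoch k A B X p (q + 1)) : Prop :=
  ∀ (p q : ℕ) (r : ℤ) (f : XCoch k A B X p q) (a : ℕ → A) (x : X) (b : ℕ → B),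
    dXR p q r f (fun i => a (i : ℕ)) x (fun j => b (j : ℕ)) =
      ε k ((q : ℤ) + r - 1) •
        f (fun i => a (i : ℕ)) (SX.actR (b 0) x) (fun j => b ((j : ℕ) + 1))
      + ∑ j : Fin q, ε k ((q : ℤ) + r + (j : ℕ)) •
          f (fun i => a (i : ℕ)) x
            (fun l => if (l : ℕ) < (j : ℕ) then b (l : ℕ)
              else if (l : ℕ) = (j : ℕ) then b (j : ℕ) * b ((j : ℕ) + 1)
              else b ((l : ℕ) + 1))
      + ε k r • SX.actR (b q) (f (fun i => a (i : ℕ)) x (fun j => b (j : ℕ)))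

/-- `pdX` is the internal differential `∂_X` on `Hoch(A,X,B)`. -/
def IsPdX (SX : ABBimod k RA RB X)
    (pdX : ∀ (p q : ℕ) (r : ℤ), XCoch k A B X p q →ₗ[k] XCoch k A B X p q) : Prop :=
  ∀ (p q : ℕ) (r : ℤ) (f : XCoch k A B X p q)
    (dga : ℕ → ℤ) (a : ℕ → A), (∀ i, a i ∈ RA.gr (dga i)) →
    ∀ (ix : ℤ) (x : X), x ∈ SX.gr ix →
    ∀ (dgb : ℕ → ℤ) (b : ℕ → B), (∀ j, b j ∈ RB.gr (dgb j)) →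
    pdX p q r f (fun i => a (i : ℕ)) x (fun j => b (j : ℕ)) =
      SX.dX (f (fun i => a (i : ℕ)) x (fun j => b (j : ℕ)))
      - ε k r • (
        (∑ i : Fin p, ε k (∑ j ∈ Finset.range (i : ℕ), dga j) •
          f (fun j => if (j : ℕ) = (i : ℕ) then RA.d (a (i : ℕ)) else a (j : ℕ)) x
            (fun j => b (j : ℕ)))
        + ε k (∑ j ∈ Finset.range p, dga j) •
            f (fun i => a (i : ℕ)) (SX.dX x) (fun j => b (j : ℕ))
        + ∑ j : Fin q, ε k ((∑ l ∈ Finset.range p, dga l) + ix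
              + (∑ l ∈ Finset.range (j : ℕ), dgb l)) •
            f (fun i => a (i : ℕ)) x
              (fun l => if (l : ℕ) = (j : ℕ) then RB.d (b (j : ℕ)) else b (l : ℕ)))

/-- `dAX` is the connecting component `d_H^{AX} : Hoch(A) → Hoch(A,X,B)`. -/
def IsDAX (SX : ABBimod k RA RB X)
    (dAX : ∀ (p : ℕ) (r : ℤ), Coch k A (p : ℤ) →ₗ[k] XCoch k A B X p 0) : Prop :=
  ∀ (p : ℕ) (r : ℤ) (fA : Coch k A (p : ℤ)) (a : ℕ → A) (x : X) (b : Fin 0 → B),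
    dAX p r fA (fun i => a (i : ℕ)) x b =
      ε k r • SX.actL (fA (fun i => a (i : ℕ))) x

/-- `dXB` is the connecting component `d_H^{XB} : Hoch(B) → Hoch(A,X,B)`. -/
def IsDXB (SX : ABBimod k RA RB X)
    (dXB : ∀ (q : ℕ) (r : ℤ), Coch k B (q : ℤ) →ₗ[k] XCoch k A B X 0 q) : Prop :=
  ∀ (q : ℕ) (r : ℤ) (fB : Coch k B (q : ℤ)) (a : Fin 0 → A)
    (ix : ℤ) (x : X), x ∈ SX.gr ix → ∀ (b : ℕ → B),
    dXB q r fB a x (fun j => b (j : ℕ)) =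
      ε k ((q : ℤ) + r - 1 + r * ix) • SX.actR (fB (fun j => b (j : ℕ))) x

/- ### The partial Hochschild sequences -/

/-- Cochains of type `Hom(X ⊗ B^{⊗q}, X)`. -/
abbrev YCoch (B X : Type) [Ring B] [Algebra k B] [AddCommGroup X] [Module k X]
    (q : ℕ) : Type :=
  X →ₗ[k] MultilinearMap k (fun _ : Fin q => B) X

/-- Cochains of type `Hom(A^{⊗p} ⊗ X, X)`. -/
abbrev ZCoch (A X : Type) [Ring A] [Algebra k A] [AddCommGroup X] [Module k X]
    (p : ℕ) : Type :=
  MultilinearMap k (fun _ : Fin p => A) (X →ₗ[k] X)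

def IsHomogY (SX : ABBimod k RA RB X) (q : ℕ) (r : ℤ) (f : YCoch k B X q) : Prop :=
  ∀ (ix : ℤ) (x : X), x ∈ SX.gr ix →
  ∀ (dgb : ℕ → ℤ) (b : ℕ → B), (∀ j, b j ∈ RB.gr (dgb j)) →
    f x (fun j => b (j : ℕ)) ∈ SX.gr (ix + (∑ j : Fin q, dgb (j : ℕ)) + r)

def IsHomogZ (SX : ABBimod k RA RB X) (p : ℕ) (r : ℤ) (f : ZCoch k A X p) : Prop :=
  ∀ (dga : ℕ → ℤ) (a : ℕ → A), (∀ i, a i ∈ RA.gr (dga i)) →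
  ∀ (ix : ℤ) (x : X), x ∈ SX.gr ix →
    f (fun i => a (i : ℕ)) x ∈ SX.gr ((∑ i : Fin p, dga (i : ℕ)) + ix + r)

/-- `dR` is the partial Hochschild differential `(d_H^X)_R` on `Hom(X⊗B^{⊗•}, X)`. -/
def IsDR (SX : ABBimod k RA RB X)
    (dR : ∀ (q : ℕ) (r : ℤ), YCoch k B X q →ₗ[k] YCoch k B X (q + 1)) : Prop :=
  ∀ (q : ℕ) (r : ℤ) (f : YCoch k B X q) (x : X) (b : ℕ → B),
    dR q r f x (fun j => b (j : ℕ)) =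
      ε k ((q : ℤ) + r - 1) • f (SX.actR (b 0) x) (fun j => b ((j : ℕ) + 1))
      + ∑ j : Fin q, ε k ((q : ℤ) + r + (j : ℕ)) •
          f x (fun l => if (l : ℕ) < (j : ℕ) then b (l : ℕ)
              else if (l : ℕ) = (j : ℕ) then b (j : ℕ) * b ((j : ℕ) + 1)
              else b ((l : ℕ) + 1))
      + ε k r • SX.actR (b q) (f x (fun j => b (j : ℕ)))

/-- `dL` is the partial Hochschild differential `(d_H^X)_L` on `Hom(A^{⊗•}⊗X, X)`. -/
def IsDL (SX : ABBimod k RA RB X)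
    (dL : ∀ (p : ℕ) (r : ℤ), ZCoch k A X p →ₗ[k] ZCoch k A X (p + 1)) : Prop :=
  ∀ (p : ℕ) (r : ℤ) (f : ZCoch k A X p)
    (dga : ℕ → ℤ) (a : ℕ → A), (∀ i, a i ∈ RA.gr (dga i)) → ∀ (x : X),
    dL p r f (fun i => a (i : ℕ)) x =
      ε k ((p : ℤ) + r + r * dga 0) • SX.actL (a 0) (f (fun i => a ((i : ℕ) + 1)) x)
      + ∑ i : Fin p, ε k ((p : ℤ) + r + (i : ℕ) + 1) •
          f (fun j => if (j : ℕ) < (i : ℕ) then a (j : ℕ)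
              else if (j : ℕ) = (i : ℕ) then a (i : ℕ) * a ((i : ℕ) + 1)
              else a ((j : ℕ) + 1)) x
      + ε k (r + 1) • f (fun i => a (i : ℕ)) (SX.actL (a p) x)

/-- Exactness of the sequence
`0 → Hom_{B^op}(X,X) ↪ Hom(X,X) → Hom(X⊗B,X) → Hom(X⊗B^{⊗2},X) → ⋯`. -/
def ExactR (SX : ABBimod k RA RB X)
    (dR : ∀ (q : ℕ) (r : ℤ), YCoch k B X q →ₗ[k] YCoch k B X (q + 1)) : Prop :=
  (∀ (r : ℤ) (f : YCoch k B X 0), IsHomogY k SX 0 r f →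
    (dR 0 r f = 0 ↔ ∀ (b : B) (x : X),
      f (SX.actR b x) (fun j => j.elim0) = SX.actR b (f x (fun j => j.elim0))))
  ∧ (∀ (q : ℕ) (r : ℤ) (f : YCoch k B X (q + 1)), IsHomogY k SX (q + 1) r f →
      dR (q + 1) r f = 0 →
      ∃ g : YCoch k B X q, IsHomogY k SX q r g ∧ dR q r g = f)

/-- Exactness of the sequence
`0 → Hom_A(X,X) ↪ Hom(X,X) → Hom(A⊗X,X) → Hom(A^{⊗2}⊗X,X) → ⋯`. -/
def ExactL (SX : ABBimod k RA RB X)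
    (dL : ∀ (p : ℕ) (r : ℤ), ZCoch k A X p →ₗ[k] ZCoch k A X (p + 1)) : Prop :=
  (∀ (r : ℤ) (f : ZCoch k A X 0), IsHomogZ k SX 0 r f →
    (dL 0 r f = 0 ↔ ∀ (i : ℤ) (a : A) (x : X), a ∈ RA.gr i →
      f (fun j => j.elim0) (SX.actL a x) = ε k (r * i) • SX.actL a (f (fun j => j.elim0) x)))
  ∧ (∀ (p : ℕ) (r : ℤ) (f : ZCoch k A X (p + 1)), IsHomogZ k SX (p + 1) r f →
      dL (p + 1) r f = 0 →
      ∃ g : ZCoch k A X p, IsHomogZ k SX p r g ∧ dL p r g = f)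

/- ### Models of `Hom_{B^op}(X,X)` and `Hom_A(X,X)` as dg bimodules -/

/-- A model `E` for the dg `A`-`A`-bimodule `Hom_{B^op}(X,X)` of graded right
`B`-linear endomorphisms of `X`, with differential `∂_X = [d_X, −]`. -/
structure EndBModel (SX : ABBimod k RA RB X) (E : Type)
    [AddCommGroup E] [Module k E] : Type where
  SE : DGBimod k RA E
  toEnd : E →ₗ[k] X →ₗ[k] X
  inj : Function.Injective toEnd
  rlin : ∀ {r : ℤ} {e : E}, e ∈ SE.gr r → ∀ (b : B) (x : X),
    toEnd e (SX.actR b x) = SX.actR b (toEnd e x)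
  graded : ∀ {r i : ℤ} {e : E} {x : X}, e ∈ SE.gr r → x ∈ SX.gr i →
    toEnd e x ∈ SX.gr (i + r)
  surj : ∀ (r : ℤ) (φ : X →ₗ[k] X),
    (∀ (b : B) (x : X), φ (SX.actR b x) = SX.actR b (φ x)) →
    (∀ (i : ℤ) (x : X), x ∈ SX.gr i → φ x ∈ SX.gr (i + r)) →
    ∃ e ∈ SE.gr r, toEnd e = φ
  d_eq : ∀ {r : ℤ} (e : E), e ∈ SE.gr r → ∀ x,
    toEnd (SE.dM e) x = SX.dX (toEnd e x) - ε k r • toEnd e (SX.dX x)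
  actL_eq : ∀ (a : A) (e : E) (x : X), toEnd (SE.actL a e) x = SX.actL a (toEnd e x)
  actR_eq : ∀ (a : A) (e : E) (x : X), toEnd (SE.actR a e) x = toEnd e (SX.actL a x)

/-- A model `E'` for the dg `B`-`B`-bimodule `Hom_A(X,X)` of graded left
`A`-linear endomorphisms of `X`, with differential `∂_X = [d_X, −]`. -/
structure EndAModel (SX : ABBimod k RA RB X) (E' : Type)
    [AddCommGroup E'] [Module k E'] : Type where
  SE : DGBimod k RB E'
  toEnd : E' →ₗ[k] X →ₗ[k] X
  inj : Function.Injective toEnd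
  llin : ∀ {r i : ℤ} {e : E'} {a : A}, e ∈ SE.gr r → a ∈ RA.gr i → ∀ x,
    toEnd e (SX.actL a x) = ε k (r * i) • SX.actL a (toEnd e x)
  graded : ∀ {r i : ℤ} {e : E'} {x : X}, e ∈ SE.gr r → x ∈ SX.gr i →
    toEnd e x ∈ SX.gr (i + r)
  surj : ∀ (r : ℤ) (φ : X →ₗ[k] X),
    (∀ (i : ℤ) (a : A) (x : X), a ∈ RA.gr i →
      φ (SX.actL a x) = ε k (r * i) • SX.actL a (φ x)) →
    (∀ (i : ℤ) (x : X), x ∈ SX.gr i → φ x ∈ SX.gr (i + r)) →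
    ∃ e ∈ SE.gr r, toEnd e = φ
  d_eq : ∀ {r : ℤ} (e : E'), e ∈ SE.gr r → ∀ x,
    toEnd (SE.dM e) x = SX.dX (toEnd e x) - ε k r • toEnd e (SX.dX x)
  actL_eq : ∀ {j r i : ℤ} (b : B) (e : E') (x : X),
    b ∈ RB.gr j → e ∈ SE.gr r → x ∈ SX.gr i →
    toEnd (SE.actL b e) x = ε k (j * (r + i)) • toEnd e (SX.actR b x)
  actR_eq : ∀ {j i : ℤ} (b : B) (e : E') (x : X), b ∈ RB.gr j → x ∈ SX.gr i →
    toEnd (SE.actR b e) x = ε k (j * i) • SX.actR b (toEnd e x)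

/-- `ρ_A : A → Hom_{B^op}(X,X)` is the left action map `ρ_A(a)(x) = a·x`. -/
def IsRhoA {E : Type} [AddCommGroup E] [Module k E] (SX : ABBimod k RA RB X)
    (EM : EndBModel k SX E) (ρA : A →ₗ[k] E) : Prop :=
  ∀ (a : A) (x : X), EM.toEnd (ρA a) x = SX.actL a x

/-- `ρ_B : B^op → Hom_A(X,X)` is the right action map
`ρ_B(b)(x) = (-1)^{|x||b|} x·b`. -/
def IsRhoB {E' : Type} [AddCommGroup E'] [Module k E'] (SX : ABBimod k RA RB X)
    (EM : EndAModel k SX E') (ρB : B →ₗ[k] E') : Prop :=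
  ∀ {j i : ℤ} (b : B) (x : X), b ∈ RB.gr j → x ∈ SX.gr i →
    EM.toEnd (ρB b) x = ε k (i * j) • SX.actR b x

/- ### The canonical embedding `Φ` -/

/-- The constant-multilinear-map inclusion. -/
def constML : X →ₗ[k] MultilinearMap k (fun _ : Fin 0 => B) X where
  toFun x := MultilinearMap.constOfIsEmpty k _ x
  map_add' x y := by ext m; simp
  map_smul' c x := by ext m; simp

/-- The embedding `Φ^{p,r} : Hoch^{p,r}(A, Hom_{B^op}(X,X)) → Hoch^{p,0,r}(A,X,B)`
(including the sign `(-1)^r`). -/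
def PhiMap {E : Type} [AddCommGroup E] [Module k E] (SX : ABBimod k RA RB X)
    (EM : EndBModel k SX E) (p : ℕ) (r : ℤ) (f : MCoch k A E p) :
    XCoch k A B X p 0 :=
  ε k r • ((((LinearMap.llcomp k X X (MultilinearMap k (fun _ : Fin 0 => B) X))
      (constML k)).comp EM.toEnd).compMultilinearMap f)

/-- The embedding `Ψ : Hoch^{q,r}(B, Hom_A(X,X)) → Hoch^{0,q,r}(A,X,B)`,
`Ψ(f)(x; b₁,…,b_q) = (-1)^{q+r-1}(-1)^{|x|(|b₁|+⋯+|b_q|)} f(b₁⊗⋯⊗b_q)(x)`. -/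
def IsPsi {E' : Type} [AddCommGroup E'] [Module k E'] (SX : ABBimod k RA RB X)
    (EM : EndAModel k SX E')
    (Psi : ∀ (q : ℕ) (r : ℤ), MCoch k B E' q →ₗ[k] XCoch k A B X 0 q) : Prop :=
  ∀ (q : ℕ) (r : ℤ) (f : MCoch k B E' q) (a : Fin 0 → A)
    (ix : ℤ) (x : X), x ∈ SX.gr ix →
    ∀ (dgb : ℕ → ℤ) (b : ℕ → B), (∀ j, b j ∈ RB.gr (dgb j)) →
    Psi q r f a x (fun j => b (j : ℕ)) =
      (ε k ((q : ℤ) + r - 1) * ε k (ix * ∑ j ∈ Finset.range q, dgb j)) •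
        EM.toEnd (f (fun j => b (j : ℕ))) x

/- ### The total Hochschild complex of the dg `A`-`B`-bimodule `X` -/

abbrev TotXCoch (A B X : Type) [Ring A] [Algebra k A] [Ring B] [Algebra k B]
    [AddCommGroup X] [Module k X] : Type := ∀ p q : ℕ, XCoch k A B X p q

def TotHomogX (SX : ABBimod k RA RB X) (n : ℤ) (cx : TotXCoch k A B X) : Prop :=
  ∀ p q : ℕ, IsHomogX k SX p q (n - p - q - 1) (cx p q)

def TotFinSuppX (cx : TotXCoch k A B X) : Prop :=
  ∃ N : ℕ, ∀ p q : ℕ, p + q ≥ N → cx p q = 0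

/-- The `X`-component of the total differential of the Hochschild complex
`Hoch_⊕(X) = Hoch_⊕(A) ⊕ Hoch_⊕(A,X,B) ⊕ Hoch_⊕(B)`, applied to an element of
total degree `n`. -/
def TotDXpart
    (dXL : ∀ (p q : ℕ) (r : ℤ), XCoch k A B X p q →ₗ[k] XCoch k A B X (p + 1) q)
    (dXR : ∀ (p q : ℕ) (r : ℤ), XCoch k A B X p q →ₗ[k] XCoch k A B X p (q + 1))
    (pdX : ∀ (p q : ℕ) (r : ℤ), XCoch k A B X p q →ₗ[k] XCoch k A B X p q)
    (dAX : ∀ (p : ℕ) (r : ℤ), Coch k A (p : ℤ) →ₗ[k] XCoch k A B X p 0)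
    (dXB : ∀ (q : ℕ) (r : ℤ), Coch k B (q : ℤ) →ₗ[k] XCoch k A B X 0 q)
    (n : ℤ) (cA : TotCoch k A) (cx : TotXCoch k A B X) (cB : TotCoch k B) :
    TotXCoch k A B X :=
  fun p q => match p, q with
  | 0, 0 => pdX 0 0 (n - 1) (cx 0 0) + dAX 0 n (cA 0) + dXB 0 n (cB 0)
  | (p + 1), 0 => pdX (p + 1) 0 (n - (p + 1) - 1) (cx (p + 1) 0)
      + dXL p 0 (n - p - 1) (cx p 0) + dAX (p + 1) (n - (p + 1)) (cA (p + 1))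
  | 0, (q + 1) => pdX 0 (q + 1) (n - (q + 1) - 1) (cx 0 (q + 1))
      + dXR 0 q (n - q - 1) (cx 0 q) + dXB (q + 1) (n - (q + 1)) (cB (q + 1))
  | (p + 1), (q + 1) => pdX (p + 1) (q + 1) (n - (p + 1) - (q + 1) - 1) (cx (p + 1) (q + 1))
      + dXL p (q + 1) (n - p - (q + 1) - 1) (cx p (q + 1))
      + dXR (p + 1) q (n - (p + 1) - q - 1) (cx (p + 1) q)

/-- A total cocycle of `Hoch_⊕(X)`, given componentwise by families
`(cA, cx, cB)` of total degree `n`. -/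
def TotXIsCocycle
    (dHA : ∀ p r : ℤ, Coch k A p →ₗ[k] Coch k A (p + 1))
    (pdA : ∀ p r : ℤ, Coch k A p →ₗ[k] Coch k A p)
    (dHB : ∀ p r : ℤ, Coch k B p →ₗ[k] Coch k B (p + 1))
    (pdB : ∀ p r : ℤ, Coch k B p →ₗ[k] Coch k B p)
    (dXL : ∀ (p q : ℕ) (r : ℤ), XCoch k A B X p q →ₗ[k] XCoch k A B X (p + 1) q)
    (dXR : ∀ (p q : ℕ) (r : ℤ), XCoch k A B X p q →ₗ[k] XCoch k A B X p (q + 1))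
    (pdX : ∀ (p q : ℕ) (r : ℤ), XCoch k A B X p q →ₗ[k] XCoch k A B X p q)
    (dAX : ∀ (p : ℕ) (r : ℤ), Coch k A (p : ℤ) →ₗ[k] XCoch k A B X p 0)
    (dXB : ∀ (q : ℕ) (r : ℤ), Coch k B (q : ℤ) →ₗ[k] XCoch k A B X 0 q)
    (n : ℤ) (cA : TotCoch k A) (cx : TotXCoch k A B X) (cB : TotCoch k B) : Prop :=
  (∀ p : ℕ, TotD k dHA pdA n cA p = 0)
  ∧ (∀ q : ℕ, TotD k dHB pdB n cB q = 0)
  ∧ (∀ p q : ℕ, TotDXpart k dXL dXR pdX dAX dXB n cA cx cB p q = 0)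

/-- `(cA, cx, cB)` (of total degree `n`) is a total coboundary in `Hoch_⊕(X)`. -/
def TotXIsCoboundary (SX : ABBimod k RA RB X)
    (dHA : ∀ p r : ℤ, Coch k A p →ₗ[k] Coch k A (p + 1))
    (pdA : ∀ p r : ℤ, Coch k A p →ₗ[k] Coch k A p)
    (dHB : ∀ p r : ℤ, Coch k B p →ₗ[k] Coch k B (p + 1))
    (pdB : ∀ p r : ℤ, Coch k B p →ₗ[k] Coch k B p)
    (dXL : ∀ (p q : ℕ) (r : ℤ), XCoch k A B X p q →ₗ[k] XCoch k A B X (p + 1) q)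
    (dXR : ∀ (p q : ℕ) (r : ℤ), XCoch k A B X p q →ₗ[k] XCoch k A B X p (q + 1))
    (pdX : ∀ (p q : ℕ) (r : ℤ), XCoch k A B X p q →ₗ[k] XCoch k A B X p q)
    (dAX : ∀ (p : ℕ) (r : ℤ), Coch k A (p : ℤ) →ₗ[k] XCoch k A B X p 0)
    (dXB : ∀ (q : ℕ) (r : ℤ), Coch k B (q : ℤ) →ₗ[k] XCoch k A B X 0 q)
    (n : ℤ) (cA : TotCoch k A) (cx : TotXCoch k A B X) (cB : TotCoch k B) : Prop :=
  ∃ (bA : TotCoch k A) (bx : TotXCoch k A B X) (bB : TotCoch k B),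
    TotHomog k RA (n - 1) bA ∧ TotFinSupp k bA ∧
    TotHomogX k SX (n - 1) bx ∧ TotFinSuppX k bx ∧
    TotHomog k RB (n - 1) bB ∧ TotFinSupp k bB ∧
    (∀ p : ℕ, cA p = TotD k dHA pdA (n - 1) bA p)
    ∧ (∀ q : ℕ, cB q = TotD k dHB pdB (n - 1) bB q)
    ∧ (∀ p q : ℕ, cx p q = TotDXpart k dXL dXR pdX dAX dXB (n - 1) bA bx bB p q)

/- ### The trivial-extension dg algebra `A ⋉ X ⋊ B` -/

variable {C : Type} [Ring C] [Algebra k C]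

/-- `(C, RC)` together with the inclusions `iA, iX, iB` and the projections
`prA, prX, prB` is a model of the trivial-extension dg algebra `A ⋉ X ⋊ B`. -/
def IsTrivExtModel (RA : DGAlgebra k A) (RB : DGAlgebra k B)
    (SX : ABBimod k RA RB X) (RC : DGAlgebra k C)
    (iA : A →ₗ[k] C) (iX : X →ₗ[k] C) (iB : B →ₗ[k] C)
    (prA : C →ₗ[k] A) (prX : C →ₗ[k] X) (prB : C →ₗ[k] B) : Prop :=
  (∀ c : C, iA (prA c) + iX (prX c) + iB (prB c) = c)
  ∧ (∀ a, prA (iA a) = a) ∧ (∀ x, prX (iX x) = x) ∧ (∀ b, prB (iB b) = b)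
  ∧ (∀ a, prX (iA a) = 0) ∧ (∀ a, prB (iA a) = 0)
  ∧ (∀ x, prA (iX x) = 0) ∧ (∀ x, prB (iX x) = 0)
  ∧ (∀ b, prA (iB b) = 0) ∧ (∀ b, prX (iB b) = 0)
  ∧ (∀ a a', iA a * iA a' = iA (a * a')) ∧ (∀ b b', iB b * iB b' = iB (b * b'))
  ∧ (∀ a x, iA a * iX x = iX (SX.actL a x)) ∧ (∀ x b, iX x * iB b = iX (SX.actR b x))
  ∧ (∀ a b, iA a * iB b = 0) ∧ (∀ b a, iB b * iA a = 0)
  ∧ (∀ x a, iX x * iA a = 0) ∧ (∀ b x, iB b * iX x = 0) ∧ (∀ x x', iX x * iX x' = 0)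
  ∧ (∀ a, RC.d (iA a) = iA (RA.d a)) ∧ (∀ x, RC.d (iX x) = iX (SX.dX x))
  ∧ (∀ b, RC.d (iB b) = iB (RB.d b))
  ∧ (∀ (i : ℤ) (a : A), a ∈ RA.gr i → iA a ∈ RC.gr i)
  ∧ (∀ (i : ℤ) (x : X), x ∈ SX.gr i → iX x ∈ RC.gr i)
  ∧ (∀ (i : ℤ) (b : B), b ∈ RB.gr i → iB b ∈ RC.gr i)

/-- Membership in the subspace `Hoch_⊕(X) ⊆ Hoch_⊕(A ⋉ X ⋊ B)`: a cochain `F`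
belongs to `Hoch_⊕(A) ⊕ Hoch_⊕(A,X,B) ⊕ Hoch_⊕(B)` (embedded via the canonical
inclusions and projections). -/
def InHochOfX (iA : A →ₗ[k] C) (iX : X →ₗ[k] C) (iB : B →ₗ[k] C)
    (prA : C →ₗ[k] A) (prX : C →ₗ[k] X) (prB : C →ₗ[k] B)
    (p : ℤ) (F : Coch k C p) : Prop :=
  ∃ (gA : Coch k A p) (gB : Coch k B p)
    (gX : ∀ pa : ℕ, XCoch k A B X pa (p.toNat - 1 - pa)),
    ∀ c : Fin p.toNat → C,
      F c = iA (gA (fun i => prA (c i))) + iB (gB (fun i => prB (c i)))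
        + ∑ s ∈ (Finset.range p.toNat).attach,
            iX (gX s.1
              (fun i : Fin s.1 =>
                prA (c ⟨i, by have := Finset.mem_range.mp s.2; have := i.isLt; omega⟩))
              (prX (c ⟨s.1, Finset.mem_range.mp s.2⟩))
              (fun j : Fin (p.toNat - 1 - s.1) =>
                prB (c ⟨s.1 + 1 + j, by
                  have := Finset.mem_range.mp s.2; have := j.isLt; omega⟩)))

/-- The projection `π_A : Hoch_⊕(A ⋉ X ⋊ B) → Hoch_⊕(A)`. -/
def piA (iA : A →ₗ[k] C) (prA : C →ₗ[k] A) {p : ℤ} (F : Coch k C p) : Coch k A p :=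
  prA.compMultilinearMap (F.compLinearMap (fun _ => iA))

/-- The projection `π_B : Hoch_⊕(A ⋉ X ⋊ B) → Hoch_⊕(B)`. -/
def piB (iB : B →ₗ[k] C) (prB : C →ₗ[k] B) {p : ℤ} (F : Coch k C p) : Coch k B p :=
  prB.compMultilinearMap (F.compLinearMap (fun _ => iB))

/-- The inclusion `ι_A : Hoch_⊕(A) → Hoch_⊕(A ⋉ X ⋊ B)`. -/
def iotaA (iA : A →ₗ[k] C) (prA : C →ₗ[k] A) {p : ℤ} (g : Coch k A p) : Coch k C p :=
  iA.compMultilinearMap (g.compLinearMap (fun _ => prA))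

/-- The inclusion `ι_B : Hoch_⊕(B) → Hoch_⊕(A ⋉ X ⋊ B)`. -/
def iotaB (iB : B →ₗ[k] C) (prB : C →ₗ[k] B) {p : ℤ} (g : Coch k B p) : Coch k C p :=
  iB.compMultilinearMap (g.compLinearMap (fun _ => prB))

/-- Multilinear maps out of a graded algebra are determined by their values on homogeneous
families. -/
theorem DGAlgebra.multilinearMap_ext (R : DGAlgebra k A) {n : ℕ}
    {f g : MultilinearMap k (fun _ : Fin n => A) M}
    (h : ∀ (dg : ℕ → ℤ) (a : ℕ → A), (∀ i, a i ∈ R.gr (dg i)) →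
      f (fun i => a (i : ℕ)) = g (fun i => a (i : ℕ))) : f = g := by
  classical
  suffices H : ∀ (s : Finset (Fin n)) (v : Fin n → A),
      (∀ i, i ∉ s → ∃ j, v i ∈ R.gr j) → f v = g v from
    MultilinearMap.ext fun v => H Finset.univ v fun i hi => absurd (Finset.mem_univ i) hi
  intro s
  induction s using Finset.induction_on with
  | empty =>
    intro v hv
    choose e he using fun i => hv i (Finset.notMem_empty i)
    have hmem : ∀ m, ext0 v m ∈ R.gr (ext0 e m) := by
      intro m
      unfold ext0
      split_ifs with hm
      · exact he _
      · exact zero_mem _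
    have hv' : (fun i : Fin n => ext0 v (i : ℕ)) = v := by
      funext i
      simp [ext0]
    simpa only [hv'] using h (ext0 e) (ext0 v) hmem
  | insert i s _ ih =>
    intro v hv
    have hvi : v i ∈ ⨆ j, R.gr j := by
      rw [R.isInternal.submodule_iSup_eq_top]
      exact Submodule.mem_top
    have key : ∀ x ∈ ⨆ j, R.gr j, f (Function.update v i x) = g (Function.update v i x) := by
      intro x hx
      induction hx using Submodule.iSup_induction' with
      | mem j x hx =>
        refine ih _ fun l hl => ?_
        by_cases hli : l = i
        · subst hli
          exact ⟨j, by simpa using hx⟩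
        · simpa [hli] using hv l (by simp [hli, hl])
      | zero => simp
      | add x y _ _ hx hy => simp [hx, hy]
    simpa using key (v i) hvi

/-- `(i, pr)` exhibits the dg algebra `A` as a retract of the dg algebra `C`, where neither map is
required to be unital. -/
structure IsDGRetract (RA : DGAlgebra k A) (RC : DGAlgebra k C)
    (i : A →ₗ[k] C) (pr : C →ₗ[k] A) : Prop where
  pr_i : ∀ a, pr (i a) = a
  i_mul : ∀ a a', i (a * a') = i a * i a'
  pr_mul : ∀ c c', pr (c * c') = pr c * pr c'
  i_d : ∀ a, i (RA.d a) = RC.d (i a)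
  pr_d : ∀ c, pr (RC.d c) = RA.d (pr c)
  i_mem : ∀ {n : ℤ} {a : A}, a ∈ RA.gr n → i a ∈ RC.gr n
  pr_mem : ∀ {n : ℤ} {c : C}, c ∈ RC.gr n → pr c ∈ RA.gr n

/-- The cochain `F` on `C` descends along `pr`: the `A`-component of its values depends only on
the `A`-components of its arguments. -/
def DescendsAlong (i : A →ₗ[k] C) (pr : C →ₗ[k] A) {p : ℤ} (F : Coch k C p) : Prop :=
  ∀ c, pr (F c) = pr (F fun m => i (pr (c m)))

theorem map_ext0 {A C : Type} [AddCommGroup A] [Module k A] [AddCommGroup C] [Module k C]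
    (φ : A →ₗ[k] C) {n : ℕ} (a : Fin n → A) (m : ℕ) :
    φ (ext0 a m) = ext0 (fun j => φ (a j)) m := by
  unfold ext0
  split_ifs <;> simp

section Retract

variable {k}
variable {RC : DGAlgebra k C} {i : A →ₗ[k] C} {pr : C →ₗ[k] A}

theorem IsDGRetract.piA_hochDiff (h : IsDGRetract k RA RC i pr)
    {dHA : ∀ p r : ℤ, Coch k A p →ₗ[k] Coch k A (p + 1)}
    {dHC : ∀ p r : ℤ, Coch k C p →ₗ[k] Coch k C (p + 1)}
    (hA : IsHochDiff k RA dHA) (hC : IsHochDiff k RC dHC)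
    {p : ℤ} (hp : 0 ≤ p) (r : ℤ) (F : Coch k C p) :
    piA k i pr (dHC p r F) = dHA p r (piA k i pr F) := by
  refine RA.multilinearMap_ext k fun dg a ha => ?_
  rw [hA p hp r _ dg a ha]
  change pr (dHC p r F fun j => i (a j)) = _
  rw [hC p hp r F dg (fun n => i (a n)) fun n => h.i_mem (ha n)]
  simp only [map_add, map_sum, map_smul, h.pr_mul, h.pr_i, piA,
    LinearMap.compMultilinearMap_apply, MultilinearMap.compLinearMap_apply, apply_ite i, h.i_mul]

theorem IsDGRetract.piA_intDiff (h : IsDGRetract k RA RC i pr)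
    {pdA : ∀ p r : ℤ, Coch k A p →ₗ[k] Coch k A p}
    {pdC : ∀ p r : ℤ, Coch k C p →ₗ[k] Coch k C p}
    (hA : IsIntDiff k RA pdA) (hC : IsIntDiff k RC pdC)
    {p : ℤ} (hp : 0 ≤ p) (r : ℤ) (F : Coch k C p) :
    piA k i pr (pdC p r F) = pdA p r (piA k i pr F) := by
  refine RA.multilinearMap_ext k fun dg a ha => ?_
  rw [hA p hp r _ dg a ha]
  change pr (pdC p r F fun j => i (a j)) = _
  rw [hC p hp r F dg (fun n => i (a n)) fun n => h.i_mem (ha n)]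
  simp only [map_sub, map_sum, map_smul, h.pr_d, piA,
    LinearMap.compMultilinearMap_apply, MultilinearMap.compLinearMap_apply, apply_ite i, h.i_d]

theorem piA_compAtF (hpr : ∀ a, pr (i a) = a) {p₁ p₂ : ℤ} {F : Coch k C p₁} {G : Coch k C p₂}
    (hF : DescendsAlong k i pr F) (n : ℕ) (a : Fin (p₁ + p₂ - 1).toNat → A) :
    pr (compAtF p₁ p₂ F G n fun m => i (a m))
      = compAtF p₁ p₂ (piA k i pr F) (piA k i pr G) n a := by
  unfold compAtF
  rw [hF]
  simp only [piA, LinearMap.compMultilinearMap_apply, MultilinearMap.compLinearMap_apply,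
    apply_ite i, apply_ite pr, map_ext0 k, hpr]

theorem iotaA_compAtF (hpr : ∀ a, pr (i a) = a) {p₁ p₂ : ℤ} (f : Coch k A p₁) (g : Coch k A p₂)
    (n : ℕ) (c : Fin (p₁ + p₂ - 1).toNat → C) :
    compAtF p₁ p₂ (iotaA k i pr f) (iotaA k i pr g) n c
      = i (compAtF p₁ p₂ f g n fun m => pr (c m)) := by
  unfold compAtF
  simp only [iotaA, LinearMap.compMultilinearMap_apply, MultilinearMap.compLinearMap_apply,
    apply_ite pr, map_ext0 k, hpr]

theorem piA_bracket (hpr : ∀ a, pr (i a) = a)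
    {brA : ∀ p₁ r₁ p₂ r₂ : ℤ, Coch k A p₁ →ₗ[k] Coch k A p₂ →ₗ[k] Coch k A (p₁ + p₂ - 1)}
    {brC : ∀ p₁ r₁ p₂ r₂ : ℤ, Coch k C p₁ →ₗ[k] Coch k C p₂ →ₗ[k] Coch k C (p₁ + p₂ - 1)}
    (hA : IsBracket k brA) (hC : IsBracket k brC) {p₁ p₂ : ℤ} (r₁ r₂ : ℤ)
    {F : Coch k C p₁} {G : Coch k C p₂}
    (hF : DescendsAlong k i pr F) (hG : DescendsAlong k i pr G) :
    piA k i pr (brC p₁ r₁ p₂ r₂ F G)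
      = brA p₁ r₁ p₂ r₂ (piA k i pr F) (piA k i pr G) := by
  ext a
  rw [hA]
  change pr (brC p₁ r₁ p₂ r₂ F G fun j => i (a j)) = _
  rw [hC]
  simp only [map_sub, map_sum, map_smul, ← piA_compAtF hpr hF, ← piA_compAtF hpr hG]

theorem iotaA_bracket (hpr : ∀ a, pr (i a) = a)
    {brA : ∀ p₁ r₁ p₂ r₂ : ℤ, Coch k A p₁ →ₗ[k] Coch k A p₂ →ₗ[k] Coch k A (p₁ + p₂ - 1)}
    {brC : ∀ p₁ r₁ p₂ r₂ : ℤ, Coch k C p₁ →ₗ[k] Coch k C p₂ →ₗ[k] Coch k C (p₁ + p₂ - 1)}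
    (hA : IsBracket k brA) (hC : IsBracket k brC) {p₁ p₂ : ℤ} (r₁ r₂ : ℤ)
    (f : Coch k A p₁) (g : Coch k A p₂) :
    iotaA k i pr (brA p₁ r₁ p₂ r₂ f g)
      = brC p₁ r₁ p₂ r₂ (iotaA k i pr f) (iotaA k i pr g) := by
  ext c
  rw [hC]
  change i (brA p₁ r₁ p₂ r₂ f g fun j => pr (c j)) = _
  rw [hA]
  simp only [map_sub, map_sum, map_smul, iotaA_compAtF hpr]

theorem IsDGRetract.piA_cup (h : IsDGRetract k RA RC i pr)
    {cupA : ∀ p₁ r₁ p₂ r₂ : ℤ, Coch k A p₁ →ₗ[k] Coch k A p₂ →ₗ[k] Coch k A (p₁ + p₂)}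
    {cupC : ∀ p₁ r₁ p₂ r₂ : ℤ, Coch k C p₁ →ₗ[k] Coch k C p₂ →ₗ[k] Coch k C (p₁ + p₂)}
    (hA : IsCup k RA cupA) (hC : IsCup k RC cupC)
    {p₁ p₂ : ℤ} (hp₁ : 0 ≤ p₁) (hp₂ : 0 ≤ p₂) (r₁ r₂ : ℤ) (F : Coch k C p₁) (G : Coch k C p₂) :
    piA k i pr (cupC p₁ r₁ p₂ r₂ F G)
      = cupA p₁ r₁ p₂ r₂ (piA k i pr F) (piA k i pr G) := by
  refine RA.multilinearMap_ext k fun dg a ha => ?_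
  rw [hA p₁ hp₁ p₂ hp₂ r₁ r₂ _ _ dg a ha]
  change pr (cupC p₁ r₁ p₂ r₂ F G fun j => i (a j)) = _
  rw [hC p₁ hp₁ p₂ hp₂ r₁ r₂ F G dg (fun n => i (a n)) fun n => h.i_mem (ha n)]
  simp only [map_smul, h.pr_mul, piA, LinearMap.compMultilinearMap_apply,
    MultilinearMap.compLinearMap_apply]

theorem IsDGRetract.iotaA_cup (h : IsDGRetract k RA RC i pr)
    {cupA : ∀ p₁ r₁ p₂ r₂ : ℤ, Coch k A p₁ →ₗ[k] Coch k A p₂ →ₗ[k] Coch k A (p₁ + p₂)}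
    {cupC : ∀ p₁ r₁ p₂ r₂ : ℤ, Coch k C p₁ →ₗ[k] Coch k C p₂ →ₗ[k] Coch k C (p₁ + p₂)}
    (hA : IsCup k RA cupA) (hC : IsCup k RC cupC)
    {p₁ p₂ : ℤ} (hp₁ : 0 ≤ p₁) (hp₂ : 0 ≤ p₂) (r₁ r₂ : ℤ) (f : Coch k A p₁) (g : Coch k A p₂) :
    iotaA k i pr (cupA p₁ r₁ p₂ r₂ f g)
      = cupC p₁ r₁ p₂ r₂ (iotaA k i pr f) (iotaA k i pr g) := by
  refine RC.multilinearMap_ext k fun dg c hc => ?_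
  rw [hC p₁ hp₁ p₂ hp₂ r₁ r₂ _ _ dg c hc]
  change i (cupA p₁ r₁ p₂ r₂ f g fun j => pr (c j)) = _
  rw [hA p₁ hp₁ p₂ hp₂ r₁ r₂ f g dg (fun n => pr (c n)) fun n => h.pr_mem (hc n)]
  simp only [map_smul, h.i_mul, iotaA, LinearMap.compMultilinearMap_apply,
    MultilinearMap.compLinearMap_apply]

end Retract

/-- The projection onto a homogeneous component of an internally graded module. -/
theorem exists_homogeneous_proj {gr : ℤ → Submodule k M} (h : DirectSum.IsInternal gr) (n : ℤ) :
    ∃ P : M →ₗ[k] M, (∀ m, P m ∈ gr n) ∧ (∀ m ∈ gr n, P m = m) ∧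
      ∀ j, j ≠ n → ∀ m ∈ gr j, P m = 0 := by
  let := h.chooseDecomposition
  refine ⟨(gr n).subtype ∘ₗ DirectSum.component k ℤ (fun j => gr j) n ∘ₗ
    (DirectSum.decomposeLinearEquiv gr).toLinearMap, fun m => Subtype.property _,
    fun m hm => ?_, fun j hj m hm => ?_⟩
  · exact DirectSum.decompose_of_mem_same gr hm
  · exact DirectSum.decompose_of_mem_ne gr hm hj

/-- Degree-preserving maps commute with the projections onto homogeneous components. -/
theorem map_homogeneous_proj {grM : ℤ → Submodule k M} {grN : ℤ → Submodule k N}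
    (hM : DirectSum.IsInternal grM) {φ : M →ₗ[k] N} (hφ : ∀ j, ∀ m ∈ grM j, φ m ∈ grN j) {n : ℤ}
    {P : M →ₗ[k] M} {Q : N →ₗ[k] N} (hP : ∀ m ∈ grM n, P m = m)
    (hP₀ : ∀ j, j ≠ n → ∀ m ∈ grM j, P m = 0) (hQ : ∀ m ∈ grN n, Q m = m)
    (hQ₀ : ∀ j, j ≠ n → ∀ m ∈ grN j, Q m = 0) (m : M) : Q (φ m) = φ (P m) := by
  have hm : m ∈ ⨆ j, grM j := by
    rw [hM.submodule_iSup_eq_top]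
    exact Submodule.mem_top
  induction hm using Submodule.iSup_induction' with
  | mem j x hx =>
    by_cases hj : j = n
    · subst hj
      rw [hP x hx, hQ _ (hφ j x hx)]
    · rw [hP₀ j hj x hx, hQ₀ j hj _ (hφ j x hx), map_zero]
  | zero => simp
  | add x y _ _ hx hy => simp [hx, hy]

section TrivExt

variable {k}
variable {SX : ABBimod k RA RB X} {RC : DGAlgebra k C}
  {iA : A →ₗ[k] C} {iX : X →ₗ[k] C} {iB : B →ₗ[k] C}
  {prA : C →ₗ[k] A} {prX : C →ₗ[k] X} {prB : C →ₗ[k] B}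

theorem IsTrivExtModel.pr_mem (h : IsTrivExtModel k RA RB SX RC iA iX iB prA prX prB)
    {n : ℤ} {c : C} (hc : c ∈ RC.gr n) : prA c ∈ RA.gr n ∧ prB c ∈ RB.gr n := by
  obtain ⟨hdec, hAA, -, hBB, -, hBA, hAX, hBX, hAB, -, -, -, -, -, -, -, -, -, -, -, -, -,
    hmA, hmX, hmB⟩ := h
  obtain ⟨PA, hPA, hPA₁, hPA₀⟩ := exists_homogeneous_proj k RA.isInternal n
  obtain ⟨PX, -, hPX₁, hPX₀⟩ := exists_homogeneous_proj k SX.isInternal n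
  obtain ⟨PB, hPB, hPB₁, hPB₀⟩ := exists_homogeneous_proj k RB.isInternal n
  obtain ⟨PC, -, hPC₁, hPC₀⟩ := exists_homogeneous_proj k RC.isInternal n
  have hsum : iA (PA (prA c)) + iX (PX (prX c)) + iB (PB (prB c)) = c := by
    rw [← map_homogeneous_proj k RA.isInternal hmA hPA₁ hPA₀ hPC₁ hPC₀,
      ← map_homogeneous_proj k SX.isInternal hmX hPX₁ hPX₀ hPC₁ hPC₀,
      ← map_homogeneous_proj k RB.isInternal hmB hPB₁ hPB₀ hPC₁ hPC₀,
      ← map_add, ← map_add, hdec, hPC₁ c hc]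
  constructor
  · rw [← hsum]
    simpa only [map_add, hAA, hAX, hAB, add_zero] using hPA (prA c)
  · rw [← hsum]
    simpa only [map_add, hBA, hBX, hBB, zero_add] using hPB (prB c)

theorem IsTrivExtModel.isDGRetract_left
    (h : IsTrivExtModel k RA RB SX RC iA iX iB prA prX prB) : IsDGRetract k RA RC iA prA := by
  have hmem {n : ℤ} {c : C} (hc : c ∈ RC.gr n) := h.pr_mem hc
  obtain ⟨hdec, hAA, -, -, -, -, hAX, -, hAB, -, mAA, mBB, mAX, mXB, mAB, mBA, mXA, mBX, mXX,
    dA, dX, dB, hmA, -, -⟩ := h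
  refine ⟨hAA, fun a a' => (mAA a a').symm, fun c c' => ?_, fun a => (dA a).symm, fun c => ?_,
    fun ha => hmA _ _ ha, fun hc => (hmem hc).1⟩
  · conv_lhs => rw [← hdec c, ← hdec c']
    simp only [mul_add, add_mul, mAA, mBB, mAX, mXB, mAB, mBA, mXA, mBX, mXX, map_add, map_zero,
      hAA, hAX, hAB, add_zero]
  · conv_lhs => rw [← hdec c]
    simp only [map_add, dA, dX, dB, hAA, hAX, hAB, add_zero]

theorem IsTrivExtModel.isDGRetract_right
    (h : IsTrivExtModel k RA RB SX RC iA iX iB prA prX prB) : IsDGRetract k RB RC iB prB := by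
  have hmem {n : ℤ} {c : C} (hc : c ∈ RC.gr n) := h.pr_mem hc
  obtain ⟨hdec, -, -, hBB, -, hBA, -, hBX, -, -, mAA, mBB, mAX, mXB, mAB, mBA, mXA, mBX, mXX,
    dA, dX, dB, -, -, hmB⟩ := h
  refine ⟨hBB, fun b b' => (mBB b b').symm, fun c c' => ?_, fun b => (dB b).symm, fun c => ?_,
    fun hb => hmB _ _ hb, fun hc => (hmem hc).2⟩
  · conv_lhs => rw [← hdec c, ← hdec c']
    simp only [mul_add, add_mul, mAA, mBB, mAX, mXB, mAB, mBA, mXA, mBX, mXX, map_add,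
      hBB, hBA, hBX, add_zero, zero_add]
  · conv_lhs => rw [← hdec c]
    simp only [map_add, dA, dX, dB, hBB, hBA, hBX, zero_add]

theorem InHochOfX.descendsAlong_left
    (h : IsTrivExtModel k RA RB SX RC iA iX iB prA prX prB) {p : ℤ} {F : Coch k C p}
    (hF : InHochOfX k iA iX iB prA prX prB p F) : DescendsAlong k iA prA F := by
  obtain ⟨-, hAA, -, -, -, -, hAX, -, hAB, -⟩ := h
  obtain ⟨gA, gB, gX, hg⟩ := hF
  intro c
  simp only [hg, map_add, map_sum, hAA, hAX, hAB, Finset.sum_const_zero, add_zero]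

theorem InHochOfX.descendsAlong_right
    (h : IsTrivExtModel k RA RB SX RC iA iX iB prA prX prB) {p : ℤ} {F : Coch k C p}
    (hF : InHochOfX k iA iX iB prA prX prB p F) : DescendsAlong k iB prB F := by
  obtain ⟨-, -, -, hBB, -, hBA, -, hBX, -⟩ := h
  obtain ⟨gA, gB, gX, hg⟩ := hF
  intro c
  simp only [hg, map_add, map_sum, hBB, hBA, hBX, Finset.sum_const_zero, add_zero, zero_add]

end TrivExt

/-- With `A`, `B` dg algebras, `X` a dg `A`-`B`-bimodule, and
`Hoch_⊕^•(X) ⊆ Hoch_⊕^•(A ⋉ X ⋊ B)`: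
(i) the natural projections `π_A`, `π_B` are cochain maps for `d_H + ∂`;
(ii) `π_A, π_B, ι_A, ι_B` respect the partial compositions `∘ᵢ` and hence
preserve the Gerstenhaber brackets;
(iii) `π_A, π_B, ι_A, ι_B` preserve the cup products. -/
theorem statement3
    (k : Type) [Field k] [CharZero k]
    (A : Type) [Ring A] [Algebra k A] (B : Type) [Ring B] [Algebra k B]
    (X : Type) [AddCommGroup X] [Module k X]
    (C : Type) [Ring C] [Algebra k C]
    (RA : KD.DGAlgebra k A) (RB : KD.DGAlgebra k B) (SX : KD.ABBimod k RA RB X)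
    (RC : KD.DGAlgebra k C)
    (iA : A →ₗ[k] C) (iX : X →ₗ[k] C) (iB : B →ₗ[k] C)
    (prA : C →ₗ[k] A) (prX : C →ₗ[k] X) (prB : C →ₗ[k] B)
    (htriv : KD.IsTrivExtModel k RA RB SX RC iA iX iB prA prX prB)
    -- the structure operators of the three Hochschild complexes:
    (dHA : ∀ p r : ℤ, KD.Coch k A p →ₗ[k] KD.Coch k A (p + 1))
    (pdA : ∀ p r : ℤ, KD.Coch k A p →ₗ[k] KD.Coch k A p)
    (cupA : ∀ p₁ r₁ p₂ r₂ : ℤ, KD.Coch k A p₁ →ₗ[k] KD.Coch k A p₂ →ₗ[k] KD.Coch k A (p₁ + p₂))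
    (brA : ∀ p₁ r₁ p₂ r₂ : ℤ, KD.Coch k A p₁ →ₗ[k] KD.Coch k A p₂ →ₗ[k] KD.Coch k A (p₁ + p₂ - 1))
    (dHB : ∀ p r : ℤ, KD.Coch k B p →ₗ[k] KD.Coch k B (p + 1))
    (pdB : ∀ p r : ℤ, KD.Coch k B p →ₗ[k] KD.Coch k B p)
    (cupB : ∀ p₁ r₁ p₂ r₂ : ℤ, KD.Coch k B p₁ →ₗ[k] KD.Coch k B p₂ →ₗ[k] KD.Coch k B (p₁ + p₂))
    (brB : ∀ p₁ r₁ p₂ r₂ : ℤ, KD.Coch k B p₁ →ₗ[k] KD.Coch k B p₂ →ₗ[k] KD.Coch k B (p₁ + p₂ - 1))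
    (dHC : ∀ p r : ℤ, KD.Coch k C p →ₗ[k] KD.Coch k C (p + 1))
    (pdC : ∀ p r : ℤ, KD.Coch k C p →ₗ[k] KD.Coch k C p)
    (cupC : ∀ p₁ r₁ p₂ r₂ : ℤ, KD.Coch k C p₁ →ₗ[k] KD.Coch k C p₂ →ₗ[k] KD.Coch k C (p₁ + p₂))
    (brC : ∀ p₁ r₁ p₂ r₂ : ℤ, KD.Coch k C p₁ →ₗ[k] KD.Coch k C p₂ →ₗ[k] KD.Coch k C (p₁ + p₂ - 1))
    (hdHA : KD.IsHochDiff k RA dHA) (hpdA : KD.IsIntDiff k RA pdA)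
    (hcupA : KD.IsCup k RA cupA) (hbrA : KD.IsBracket k brA)
    (hdHB : KD.IsHochDiff k RB dHB) (hpdB : KD.IsIntDiff k RB pdB)
    (hcupB : KD.IsCup k RB cupB) (hbrB : KD.IsBracket k brB)
    (hdHC : KD.IsHochDiff k RC dHC) (hpdC : KD.IsIntDiff k RC pdC)
    (hcupC : KD.IsCup k RC cupC) (hbrC : KD.IsBracket k brC) :
    -- (i) the projections are cochain maps:
    (∀ (p : ℕ) (r : ℤ) (F : KD.Coch k C (p : ℤ)), KD.IsHomog k RC p r F →
      KD.InHochOfX k iA iX iB prA prX prB p F →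
      KD.piA k iA prA (dHC p r F) = dHA p r (KD.piA k iA prA F)
      ∧ KD.piA k iA prA (pdC p r F) = pdA p r (KD.piA k iA prA F)
      ∧ KD.piB k iB prB (dHC p r F) = dHB p r (KD.piB k iB prB F)
      ∧ KD.piB k iB prB (pdC p r F) = pdB p r (KD.piB k iB prB F))
    ∧ -- (ii) `π_A, π_B` respect the compositions `∘ᵢ` …
    (∀ (p₁ p₂ : ℕ) (F : KD.Coch k C (p₁ : ℤ)) (G : KD.Coch k C (p₂ : ℤ)),
      KD.InHochOfX k iA iX iB prA prX prB p₁ F →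
      KD.InHochOfX k iA iX iB prA prX prB p₂ G →
      ∀ (i : ℕ) (a : Fin ((p₁ : ℤ) + (p₂ : ℤ) - 1).toNat → A),
        prA (KD.compAtF (p₁ : ℤ) (p₂ : ℤ) ⇑F ⇑G i (fun m => iA (a m)))
          = KD.compAtF (p₁ : ℤ) (p₂ : ℤ) ⇑(KD.piA k iA prA F) ⇑(KD.piA k iA prA G) i a)
    ∧ (∀ (p₁ p₂ : ℕ) (F : KD.Coch k C (p₁ : ℤ)) (G : KD.Coch k C (p₂ : ℤ)),
      KD.InHochOfX k iA iX iB prA prX prB p₁ F →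
      KD.InHochOfX k iA iX iB prA prX prB p₂ G →
      ∀ (i : ℕ) (b : Fin ((p₁ : ℤ) + (p₂ : ℤ) - 1).toNat → B),
        prB (KD.compAtF (p₁ : ℤ) (p₂ : ℤ) ⇑F ⇑G i (fun m => iB (b m)))
          = KD.compAtF (p₁ : ℤ) (p₂ : ℤ) ⇑(KD.piB k iB prB F) ⇑(KD.piB k iB prB G) i b)
    ∧ -- … `ι_A, ι_B` respect the compositions `∘ᵢ` …
    (∀ (p₁ p₂ : ℕ) (g : KD.Coch k A (p₁ : ℤ)) (g' : KD.Coch k A (p₂ : ℤ))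
      (i : ℕ) (c : Fin ((p₁ : ℤ) + (p₂ : ℤ) - 1).toNat → C),
        KD.compAtF (p₁ : ℤ) (p₂ : ℤ) ⇑(KD.iotaA k iA prA g) ⇑(KD.iotaA k iA prA g') i c
          = iA (KD.compAtF (p₁ : ℤ) (p₂ : ℤ) ⇑g ⇑g' i (fun m => prA (c m))))
    ∧ (∀ (p₁ p₂ : ℕ) (g : KD.Coch k B (p₁ : ℤ)) (g' : KD.Coch k B (p₂ : ℤ))
      (i : ℕ) (c : Fin ((p₁ : ℤ) + (p₂ : ℤ) - 1).toNat → C),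
        KD.compAtF (p₁ : ℤ) (p₂ : ℤ) ⇑(KD.iotaB k iB prB g) ⇑(KD.iotaB k iB prB g') i c
          = iB (KD.compAtF (p₁ : ℤ) (p₂ : ℤ) ⇑g ⇑g' i (fun m => prB (c m))))
    ∧ -- … and hence all four maps preserve the Gerstenhaber brackets:
    (∀ (p₁ p₂ : ℕ) (r₁ r₂ : ℤ) (F : KD.Coch k C (p₁ : ℤ)) (G : KD.Coch k C (p₂ : ℤ)),
      KD.IsHomog k RC p₁ r₁ F → KD.IsHomog k RC p₂ r₂ G →
      KD.InHochOfX k iA iX iB prA prX prB p₁ F →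
      KD.InHochOfX k iA iX iB prA prX prB p₂ G →
      KD.piA k iA prA (brC p₁ r₁ p₂ r₂ F G)
        = brA p₁ r₁ p₂ r₂ (KD.piA k iA prA F) (KD.piA k iA prA G)
      ∧ KD.piB k iB prB (brC p₁ r₁ p₂ r₂ F G)
        = brB p₁ r₁ p₂ r₂ (KD.piB k iB prB F) (KD.piB k iB prB G))
    ∧ (∀ (p₁ p₂ : ℕ) (r₁ r₂ : ℤ) (g : KD.Coch k A (p₁ : ℤ)) (g' : KD.Coch k A (p₂ : ℤ)),
      KD.IsHomog k RA p₁ r₁ g → KD.IsHomog k RA p₂ r₂ g' →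
      KD.iotaA k iA prA (brA p₁ r₁ p₂ r₂ g g')
        = brC p₁ r₁ p₂ r₂ (KD.iotaA k iA prA g) (KD.iotaA k iA prA g'))
    ∧ (∀ (p₁ p₂ : ℕ) (r₁ r₂ : ℤ) (g : KD.Coch k B (p₁ : ℤ)) (g' : KD.Coch k B (p₂ : ℤ)),
      KD.IsHomog k RB p₁ r₁ g → KD.IsHomog k RB p₂ r₂ g' →
      KD.iotaB k iB prB (brB p₁ r₁ p₂ r₂ g g')
        = brC p₁ r₁ p₂ r₂ (KD.iotaB k iB prB g) (KD.iotaB k iB prB g'))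
    ∧ -- (iii) all four maps preserve the cup products:
    (∀ (p₁ p₂ : ℕ) (r₁ r₂ : ℤ) (F : KD.Coch k C (p₁ : ℤ)) (G : KD.Coch k C (p₂ : ℤ)),
      KD.IsHomog k RC p₁ r₁ F → KD.IsHomog k RC p₂ r₂ G →
      KD.InHochOfX k iA iX iB prA prX prB p₁ F →
      KD.InHochOfX k iA iX iB prA prX prB p₂ G →
      KD.piA k iA prA (cupC p₁ r₁ p₂ r₂ F G)
        = cupA p₁ r₁ p₂ r₂ (KD.piA k iA prA F) (KD.piA k iA prA G)
      ∧ KD.piB k iB prB (cupC p₁ r₁ p₂ r₂ F G)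
        = cupB p₁ r₁ p₂ r₂ (KD.piB k iB prB F) (KD.piB k iB prB G))
    ∧ (∀ (p₁ p₂ : ℕ) (r₁ r₂ : ℤ) (g : KD.Coch k A (p₁ : ℤ)) (g' : KD.Coch k A (p₂ : ℤ)),
      KD.IsHomog k RA p₁ r₁ g → KD.IsHomog k RA p₂ r₂ g' →
      KD.iotaA k iA prA (cupA p₁ r₁ p₂ r₂ g g')
        = cupC p₁ r₁ p₂ r₂ (KD.iotaA k iA prA g) (KD.iotaA k iA prA g'))
    ∧ (∀ (p₁ p₂ : ℕ) (r₁ r₂ : ℤ) (g : KD.Coch k B (p₁ : ℤ)) (g' : KD.Coch k B (p₂ : ℤ)),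
      KD.IsHomog k RB p₁ r₁ g → KD.IsHomog k RB p₂ r₂ g' →
      KD.iotaB k iB prB (cupB p₁ r₁ p₂ r₂ g g')
        = cupC p₁ r₁ p₂ r₂ (KD.iotaB k iB prB g) (KD.iotaB k iB prB g')) := by
  have hA := htriv.isDGRetract_left
  have hB := htriv.isDGRetract_right
  refine ⟨fun p r F _ _ => ⟨?_, ?_, ?_, ?_⟩, fun p₁ p₂ F G hF _ => ?_, fun p₁ p₂ F G hF _ => ?_,
    fun p₁ p₂ g g' => iotaA_compAtF hA.pr_i g g', fun p₁ p₂ g g' => iotaA_compAtF hB.pr_i g g',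
    fun p₁ p₂ r₁ r₂ F G _ _ hF hG => ⟨?_, ?_⟩,
    fun p₁ p₂ r₁ r₂ g g' _ _ => iotaA_bracket hA.pr_i hbrA hbrC r₁ r₂ g g',
    fun p₁ p₂ r₁ r₂ g g' _ _ => iotaA_bracket hB.pr_i hbrB hbrC r₁ r₂ g g',
    fun p₁ p₂ r₁ r₂ F G _ _ _ _ => ⟨?_, ?_⟩,
    fun p₁ p₂ r₁ r₂ g g' _ _ => ?_, fun p₁ p₂ r₁ r₂ g g' _ _ => ?_⟩
  · exact hA.piA_hochDiff hdHA hdHC p.cast_nonneg r F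
  · exact hA.piA_intDiff hpdA hpdC p.cast_nonneg r F
  · exact hB.piA_hochDiff hdHB hdHC p.cast_nonneg r F
  · exact hB.piA_intDiff hpdB hpdC p.cast_nonneg r F
  · exact piA_compAtF hA.pr_i (hF.descendsAlong_left htriv)
  · exact piA_compAtF hB.pr_i (hF.descendsAlong_right htriv)
  · exact piA_bracket hA.pr_i hbrA hbrC r₁ r₂ (hF.descendsAlong_left htriv)
      (hG.descendsAlong_left htriv)
  · exact piA_bracket hB.pr_i hbrB hbrC r₁ r₂ (hF.descendsAlong_right htriv)
      (hG.descendsAlong_right htriv)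
  · exact hA.piA_cup hcupA hcupC p₁.cast_nonneg p₂.cast_nonneg r₁ r₂ F G
  · exact hB.piA_cup hcupB hcupC p₁.cast_nonneg p₂.cast_nonneg r₁ r₂ F G
  · exact hA.iotaA_cup hcupA hcupC p₁.cast_nonneg p₂.cast_nonneg r₁ r₂ g g'
  · exact hB.iotaA_cup hcupB hcupC p₁.cast_nonneg p₂.cast_nonneg r₁ r₂ g g'
end KD
end
end

section
/- Let (A, d_A) be a dg algebra over a field k of characteristic zero, let (M, d_M) be an acyclic dg A-A-bimodule with contracting homotopy h, and let H := h∘(−) and 𝔥_k := (H∘d_H)^k∘H for k ≥ 0. Then the map 𝔥 := Σ_{k=0}^∞ (-1)^k 𝔥_k : Hoch_⊕^•(A,M) → Hoch_∏^{•−1}(A,M) satisfies 𝔥∘(∂ + d_H)(f) + (∂ + d_H)∘𝔥(f) = f for every f ∈ Hoch_⊕^•(A,M). In particular, for every k ≥ 1 one has ∂∘𝔥_k + 𝔥_k∘∂ = d_H∘𝔥_{k−1} + 𝔥_{k−1}∘d_H. -/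
set_option maxHeartbeats 1000000
set_option synthInstance.maxHeartbeats 400000
set_option linter.unusedVariables false

noncomputable section

namespace KD

open scoped BigOperators TensorProduct

variable (k : Type) [Field k]

variable {A : Type} [Ring A] [Algebra k A]

/- ## Differential graded bimodules and Hochschild cochains with coefficients -/

variable {M : Type} [AddCommGroup M] [Module k M]

variable {R : DGAlgebra k A}

/- Morphisms of dg bimodules, quasi-isomorphisms, mapping cones -/

variable {N : Type} [AddCommGroup N] [Module k N]

/- Signs -/

theorem ε_add (m n : ℤ) : ε k (m + n) = ε k m * ε k n := by
  unfold ε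
  by_cases hm : Even m <;> by_cases hn : Even n <;> simp [Int.even_add, hm, hn]

theorem ε_zero : ε k 0 = 1 := by simp [ε]

theorem ε_one : ε k 1 = -1 := by simp [ε]

theorem ε_mul_self (n : ℤ) : ε k n * ε k n = 1 := by
  unfold ε
  split_ifs <;> simp

theorem ε_sub (m n : ℤ) : ε k (m - n) = ε k m * ε k n := by
  have h := ε_add k (m - n) n
  rw [sub_add_cancel] at h
  rw [h, mul_assoc, ε_mul_self, mul_one]

/- Finite sums -/

theorem sum_range_merge {X : Type} [AddCommMonoid X] (g g' : ℕ → X) {i p : ℕ} (hi : i < p)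
    (hlt : ∀ l, l < i → g l = g' l) (heq : g i + g (i + 1) = g' i)
    (hgt : ∀ l, i < l → g (l + 1) = g' l) :
    ∑ l ∈ Finset.range (p + 1), g l = ∑ l ∈ Finset.range p, g' l := by
  induction p, hi using Nat.le_induction with
  | base =>
    rw [Finset.sum_range_succ, Finset.sum_range_succ, Finset.sum_range_succ, add_assoc, heq]
    congr 1
    exact Finset.sum_congr rfl fun l hl => hlt l (Finset.mem_range.mp hl)
  | succ q hq ih =>
    rw [Finset.sum_range_succ, ih, Finset.sum_range_succ _ q, hgt q hq]

/-- The cancellation behind `d² = 0` for the alternating sum of the cofaces of a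
cosimplicial object. -/
theorem sum_alternating_eq_zero (T : ℕ → ℕ → M) (n : ℕ)
    (hT : ∀ i j, i ≤ j → j < n → T (j + 1) i = T i j) :
    ∑ j ∈ Finset.range (n + 1), ε k j • ∑ i ∈ Finset.range n, ε k i • T j i = 0 := by
  induction n with
  | zero => simp
  | succ n ih =>
    have hcol : ∀ j ∈ Finset.range (n + 1), ε k j • ε k n • T j n =
        ε k n • ε k j • T (n + 1) j := by
      intro j hj
      rw [hT j n (by simpa [Nat.lt_succ_iff] using hj) (by omega), smul_comm]
    rw [Finset.sum_range_succ]
    have hsplit : ∀ j, ∑ i ∈ Finset.range (n + 1), ε k i • T j i =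
        ∑ i ∈ Finset.range n, ε k i • T j i + ε k n • T j n :=
      fun j => Finset.sum_range_succ _ n
    simp only [hsplit, smul_add, Finset.sum_add_distrib]
    rw [Finset.sum_congr rfl hcol, ← Finset.smul_sum, hsplit (n + 1),
      ih fun i j hij hj => hT i j hij (by omega)]
    push_cast
    simp only [ε_add, ε_one]
    module

/- Sequences -/

/-- Combine the entries `i` and `i + 1` of a sequence. -/
def mergeAt {X : Type} (op : X → X → X) (i : ℕ) (a : ℕ → X) : ℕ → X :=
  fun j => if j < i then a j else if j = i then op (a i) (a (i + 1)) else a (j + 1)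

theorem mergeAt_of_lt {X : Type} (op : X → X → X) {i j : ℕ} (a : ℕ → X) (h : j < i) :
    mergeAt op i a j = a j := by simp [mergeAt, h]

theorem mergeAt_self {X : Type} (op : X → X → X) (i : ℕ) (a : ℕ → X) :
    mergeAt op i a i = op (a i) (a (i + 1)) := by simp [mergeAt]

theorem mergeAt_of_gt {X : Type} (op : X → X → X) {i j : ℕ} (a : ℕ → X) (h : i < j) :
    mergeAt op i a j = a (j + 1) := by simp [mergeAt, h.not_gt, h.ne']

theorem mergeAt_mergeAt {X : Type} (op : X → X → X)
    (hop : ∀ x y z, op (op x y) z = op x (op y z)) {i j : ℕ} (hij : i ≤ j) (a : ℕ → X) :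
    mergeAt op i (mergeAt op (j + 1) a) = mergeAt op j (mergeAt op i a) := by
  funext l
  simp only [mergeAt]
  grind

theorem mergeAt_mem (R : DGAlgebra k A) {a : ℕ → A} {dg : ℕ → ℤ}
    (ha : ∀ i, a i ∈ R.gr (dg i)) (i j : ℕ) :
    mergeAt (· * ·) i a j ∈ R.gr (mergeAt (· + ·) i dg j) := by
  unfold mergeAt
  split_ifs
  exacts [ha _, R.mul_mem (ha _) (ha _), ha _]

theorem update_d_mem (R : DGAlgebra k A) {a : ℕ → A} {dg : ℕ → ℤ}
    (ha : ∀ i, a i ∈ R.gr (dg i)) (i j : ℕ) :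
    Function.update a i (R.d (a i)) j ∈ R.gr (Function.update dg i (dg i + 1) j) := by
  by_cases hj : j = i
  · subst hj; simpa using R.d_mem (ha j)
  · simpa [hj] using ha j

theorem sum_range_mergeAt (dg : ℕ → ℤ) {i p : ℕ} (hi : i < p) :
    ∑ l ∈ Finset.range p, mergeAt (· + ·) i dg l = ∑ l ∈ Finset.range (p + 1), dg l :=
  (sum_range_merge _ _ hi (fun _ hl => (mergeAt_of_lt _ _ hl).symm) (mergeAt_self _ _ _).symm
    fun _ hl => (mergeAt_of_gt _ _ hl).symm).symm

/- Cochains evaluated on sequences -/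

/-- The value of a cochain on the initial segment of a sequence. -/
def evalSeq {p : ℕ} (f : MCoch k A M p) (a : ℕ → A) (_dg : ℕ → ℤ) : M :=
  f fun i => a i

theorem evalSeq_congr {p : ℕ} (f : MCoch k A M p) {a b : ℕ → A} (dg dg' : ℕ → ℤ)
    (hab : ∀ i, i < p → a i = b i) : evalSeq k f a dg = evalSeq k f b dg' :=
  congrArg f (funext fun i => hab i i.2)

theorem evalSeq_update {p : ℕ} (f : MCoch k A M p) (a : ℕ → A) (dg : ℕ → ℤ) {i : ℕ}
    (hi : i < p) (x : A) :
    evalSeq k f (Function.update a i x) dg =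
      f (Function.update (fun j : Fin p => a j) ⟨i, hi⟩ x) := by
  refine congrArg f (funext fun j => ?_)
  by_cases hj : j = ⟨i, hi⟩
  · subst hj; simp
  · have : (j : ℕ) ≠ i := fun h => hj (Fin.ext h)
    simp [hj, this]

/-- Multilinear maps are determined by their values on homogeneous arguments. -/
theorem mcoch_ext_homogeneous (R : DGAlgebra k A) {p : ℕ} {f g : MCoch k A M p}
    (hfg : ∀ (dg : ℕ → ℤ) (a : ℕ → A), (∀ i, a i ∈ R.gr (dg i)) →
      f (fun i => a i) = g (fun i => a i)) : f = g := by
  classical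
  have hdecomp : ∀ x : A, ∃ (s : Finset ℤ) (y : ℤ → A), (∀ i, y i ∈ R.gr i) ∧
      x = ∑ i ∈ s, y i := by
    intro x
    obtain ⟨v, rfl⟩ := R.isInternal.surjective x
    refine ⟨DFinsupp.support v, fun i => (v i : A), fun i => (v i).2, ?_⟩
    simp [DirectSum.coeAddMonoidHom_eq_dfinsuppSum, DFinsupp.sum]
  choose s y hy hx using hdecomp
  ext b
  have hb : b = fun i => ∑ j ∈ s (b i), y (b i) j := funext fun i => hx (b i)
  rw [hb, MultilinearMap.map_sum_finset, MultilinearMap.map_sum_finset]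
  refine Finset.sum_congr rfl fun e _ => ?_
  have key := hfg (fun i => if h : i < p then e ⟨i, h⟩ else 0)
    (fun i => if h : i < p then y (b ⟨i, h⟩) (e ⟨i, h⟩) else 0) (by
      intro i
      by_cases h : i < p <;> simp [h, hy])
  simpa using key

/-- The `i`-th coface of the Hochschild complex. -/
def coface (St : DGBimod k R M) (p : ℕ) (r : ℤ) (i : ℕ) (F : (ℕ → A) → (ℕ → ℤ) → M)
    (a : ℕ → A) (dg : ℕ → ℤ) : M :=
  match i with
  | 0 => ε k (r * dg 0) • St.actL (a 0) (F (fun j => a (j + 1)) (fun j => dg (j + 1)))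
  | i + 1 => if i < p then F (mergeAt (· * ·) i a) (mergeAt (· + ·) i dg)
      else St.actR (a p) (F a dg)

theorem coface_congr (St : DGBimod k R M) (p : ℕ) (r : ℤ) (i : ℕ)
    {F G : (ℕ → A) → (ℕ → ℤ) → M}
    (hFG : ∀ a dg, (∀ i, a i ∈ R.gr (dg i)) → F a dg = G a dg)
    {a : ℕ → A} {dg : ℕ → ℤ} (ha : ∀ i, a i ∈ R.gr (dg i)) :
    coface k St p r i F a dg = coface k St p r i G a dg := by
  cases i with
  | zero => simp only [coface]; rw [hFG _ _ fun j => ha (j + 1)]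
  | succ i => simp only [coface]; rw [hFG _ _ ha, hFG _ _ (mergeAt_mem k R ha i)]

theorem coface_smul (St : DGBimod k R M) (p : ℕ) (r : ℤ) (i : ℕ) (c : k)
    (F : (ℕ → A) → (ℕ → ℤ) → M) (a : ℕ → A) (dg : ℕ → ℤ) :
    coface k St p r i (fun a dg => c • F a dg) a dg = c • coface k St p r i F a dg := by
  cases i with
  | zero => simp only [coface, map_smul]; rw [smul_comm]
  | succ i => simp only [coface, map_smul]; split_ifs <;> rfl

theorem coface_sum (St : DGBimod k R M) (p : ℕ) (r : ℤ) (i : ℕ) (s : Finset ℕ)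
    (F : ℕ → (ℕ → A) → (ℕ → ℤ) → M) (a : ℕ → A) (dg : ℕ → ℤ) :
    coface k St p r i (fun a dg => ∑ l ∈ s, F l a dg) a dg =
      ∑ l ∈ s, coface k St p r i (F l) a dg := by
  cases i with
  | zero => simp only [coface, map_sum, Finset.smul_sum]
  | succ i => simp only [coface, map_sum]; split_ifs <;> rfl

theorem coface_coface (St : DGBimod k R M) (p : ℕ) (r : ℤ) (f : MCoch k A M p)
    (a : ℕ → A) (dg : ℕ → ℤ) {i j : ℕ} (hij : i ≤ j) (hj : j < p + 2) :
    coface k St (p + 1) r (j + 1) (coface k St p r i (evalSeq k f)) a dg =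
      coface k St (p + 1) r i (coface k St p r j (evalSeq k f)) a dg := by
  rcases i with _ | i
  · rcases j with _ | j
    · simp only [coface, Nat.succ_pos, if_true, mergeAt_self, map_smul, smul_smul,
        St.actL_mul, mul_add, ε_add]
      congr 3
    · simp only [coface, Nat.add_lt_add_iff_right]
      split_ifs with h
      · rw [mergeAt_of_lt _ _ (Nat.succ_pos j), mergeAt_of_lt _ _ (Nat.succ_pos j)]
        congr 2
        refine evalSeq_congr k f _ _ fun l _ => ?_
        simp [mergeAt]
      · rw [map_smul, St.actLR]
  · obtain ⟨j, rfl⟩ : ∃ l, j = l + 1 := ⟨j - 1, by omega⟩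
    simp only [coface, Nat.add_lt_add_iff_right]
    rw [if_pos (show i < p + 1 by omega)]
    by_cases hjp : j < p
    · rw [if_pos hjp, if_pos (show i < p by omega), if_pos hjp,
        mergeAt_mergeAt _ mul_assoc (by omega), mergeAt_mergeAt _ add_assoc (by omega)]
    · rw [if_neg hjp, if_neg hjp]
      by_cases hip : i < p
      · rw [if_pos hip, mergeAt_of_gt _ _ hip]
      · obtain rfl : i = p := by omega
        rw [if_neg hip, mergeAt_self, St.actR_mul,
          evalSeq_congr k f dg (mergeAt (· + ·) i dg)
            fun l hl => (mergeAt_of_lt (· * ·) a hl).symm]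

theorem hochDiff_apply {St : DGBimod k R M}
    {dHM : ∀ (p : ℕ) (r : ℤ), MCoch k A M p →ₗ[k] MCoch k A M (p + 1)}
    (hdHM : IsHochDiffM k St dHM) (p : ℕ) (r : ℤ) (f : MCoch k A M p)
    {a : ℕ → A} {dg : ℕ → ℤ} (ha : ∀ i, a i ∈ R.gr (dg i)) :
    evalSeq k (dHM p r f) a dg = ε k (p + r - 1) •
      ∑ i ∈ Finset.range (p + 2), ε k i • coface k St p r i (evalSeq k f) a dg := by
  have h := hdHM p r f dg a ha
  rw [evalSeq, h, Finset.sum_range_succ', Finset.sum_range_succ,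
    Finset.sum_congr (g := fun i : ℕ => ε k ((i + 1 : ℕ) : ℤ) •
      evalSeq k f (mergeAt (· * ·) i a) (mergeAt (· + ·) i dg)) rfl
      (fun i hi => by simp only [coface]; rw [if_pos (Finset.mem_range.mp hi)]),
    Finset.sum_range]
  simp only [coface, lt_irrefl, if_false]
  rw [smul_add, smul_add, add_assoc, add_comm]
  refine congrArg₂ _ (congrArg₂ _ ?_ ?_) ?_
  · rw [Finset.smul_sum]
    refine Finset.sum_congr rfl fun i _ => ?_
    rw [smul_smul, ← ε_add]
    congr 2
    push_cast
    ring
  · rw [smul_smul, ← ε_add]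
    have : (p : ℤ) + r - 1 + ((p + 1 : ℕ) : ℤ) = r + (p + p) := by push_cast; ring
    rw [this, ε_add, ε_add, ε_mul_self, mul_one]
    rfl
  · rw [smul_smul, smul_smul, Nat.cast_zero, ε_zero, mul_one, ← ε_add]
    rfl

theorem hochDiff_hochDiff {St : DGBimod k R M}
    {dHM : ∀ (p : ℕ) (r : ℤ), MCoch k A M p →ₗ[k] MCoch k A M (p + 1)}
    (hdHM : IsHochDiffM k St dHM) (p : ℕ) (r : ℤ) (f : MCoch k A M p) :
    dHM (p + 1) r (dHM p r f) = 0 := by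
  refine mcoch_ext_homogeneous k R fun dg a ha => ?_
  change evalSeq k (dHM (p + 1) r (dHM p r f)) a dg = 0
  rw [hochDiff_apply k hdHM _ _ _ ha]
  have hinner : ∀ j, coface k St (p + 1) r j (evalSeq k (dHM p r f)) a dg =
      ε k (p + r - 1) • ∑ i ∈ Finset.range (p + 2), ε k i •
        coface k St (p + 1) r j (coface k St p r i (evalSeq k f)) a dg := by
    intro j
    rw [coface_congr k St _ _ _ (fun b dg' hb => hochDiff_apply k hdHM p r f hb) ha,
      coface_smul, coface_sum]
    simp only [coface_smul]
  simp only [hinner, smul_comm _ (ε k (p + r - 1))]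
  rw [← Finset.smul_sum, sum_alternating_eq_zero k
    (fun j i => coface k St (p + 1) r j (coface k St p r i (evalSeq k f)) a dg) (p + 2)
    fun i j hij hj => coface_coface k St p r f a dg hij hj, smul_zero, smul_zero]

/- The internal differential -/

/-- The internal differential on functions of homogeneous sequences. -/
def intDiffSeq (St : DGBimod k R M) (p : ℕ) (r : ℤ) (F : (ℕ → A) → (ℕ → ℤ) → M)
    (a : ℕ → A) (dg : ℕ → ℤ) : M :=
  St.dM (F a dg) - ε k r • ∑ i ∈ Finset.range p, ε k (∑ j ∈ Finset.range i, dg j) •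
    F (Function.update a i (R.d (a i))) (Function.update dg i (dg i + 1))

theorem intDiffSeq_congr (St : DGBimod k R M) (p : ℕ) (r : ℤ)
    {F G : (ℕ → A) → (ℕ → ℤ) → M}
    (hFG : ∀ a dg, (∀ i, a i ∈ R.gr (dg i)) → F a dg = G a dg)
    {a : ℕ → A} {dg : ℕ → ℤ} (ha : ∀ i, a i ∈ R.gr (dg i)) :
    intDiffSeq k St p r F a dg = intDiffSeq k St p r G a dg := by
  simp only [intDiffSeq, hFG _ _ ha, fun i => hFG _ _ (update_d_mem k R ha i)]

theorem intDiffSeq_smul (St : DGBimod k R M) (p : ℕ) (r : ℤ) (c : k)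
    (F : (ℕ → A) → (ℕ → ℤ) → M) (a : ℕ → A) (dg : ℕ → ℤ) :
    intDiffSeq k St p r (fun a dg => c • F a dg) a dg = c • intDiffSeq k St p r F a dg := by
  simp only [intDiffSeq, map_smul, smul_sub, smul_comm _ c, ← Finset.smul_sum]

theorem intDiffSeq_sum (St : DGBimod k R M) (p : ℕ) (r : ℤ) (s : Finset ℕ)
    (F : ℕ → (ℕ → A) → (ℕ → ℤ) → M) (a : ℕ → A) (dg : ℕ → ℤ) :
    intDiffSeq k St p r (fun a dg => ∑ l ∈ s, F l a dg) a dg =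
      ∑ l ∈ s, intDiffSeq k St p r (F l) a dg := by
  simp only [intDiffSeq, map_sum, Finset.sum_sub_distrib, Finset.smul_sum]
  rw [Finset.sum_comm]

theorem intDiff_apply {St : DGBimod k R M}
    {pdM : ∀ (p : ℕ) (r : ℤ), MCoch k A M p →ₗ[k] MCoch k A M p}
    (hpdM : IsIntDiffM k St pdM) (p : ℕ) (r : ℤ) (f : MCoch k A M p)
    {a : ℕ → A} {dg : ℕ → ℤ} (ha : ∀ i, a i ∈ R.gr (dg i)) :
    evalSeq k (pdM p r f) a dg = intDiffSeq k St p r (evalSeq k f) a dg := by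
  rw [evalSeq, hpdM p r f dg a ha, intDiffSeq, Finset.sum_range]
  simp only [evalSeq, Function.update_apply]

theorem intDiffSeq_coface (St : DGBimod k R M) (p : ℕ) (r : ℤ) {f : MCoch k A M p}
    (hf : IsHomogM k St p r f) {a : ℕ → A} {dg : ℕ → ℤ} (ha : ∀ i, a i ∈ R.gr (dg i)) (i : ℕ) :
    intDiffSeq k St (p + 1) r (coface k St p r i (evalSeq k f)) a dg =
      coface k St p (r + 1) i (intDiffSeq k St p r (evalSeq k f)) a dg := by
  rcases i with _ | i
  · have hupd : ∀ l, evalSeq k f (fun j => Function.update a (l + 1) (R.d (a (l + 1))) (j + 1))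
        (fun j => Function.update dg (l + 1) (dg (l + 1) + 1) (j + 1)) =
        evalSeq k f (Function.update (fun j => a (j + 1)) l (R.d (a (l + 1))))
          (Function.update (fun j => dg (j + 1)) l (dg (l + 1) + 1)) := fun l =>
      evalSeq_congr k f _ _ fun j _ => by simp [Function.update_apply]
    have hzero : evalSeq k f (fun j => Function.update a 0 (R.d (a 0)) (j + 1))
        (fun j => Function.update dg 0 (dg 0 + 1) (j + 1)) =
        evalSeq k f (fun j => a (j + 1)) (fun j => dg (j + 1)) :=
      evalSeq_congr k f _ _ fun j _ => by simp
    simp only [intDiffSeq, coface, Finset.sum_range_succ', hupd, hzero, Function.update_self,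
      Function.update_of_ne (Nat.succ_ne_zero _).symm, Finset.sum_range_zero, map_smul,
      map_sub, map_sum, St.dM_actL _ _ (ha 0), ε_add, mul_add, add_mul, mul_one, one_mul, ε_zero,
      smul_add, smul_sub, Finset.smul_sum, smul_smul]
    rw [mul_left_comm (ε k r) (ε k (r * dg 0)), ε_mul_self, mul_one,
      Finset.sum_congr rfl fun l _ => by
        rw [show ε k r * (ε k (∑ j ∈ Finset.range l, dg (j + 1)) * ε k (dg 0) * ε k (r * dg 0)) =
          ε k (r * dg 0) * ε k (dg 0) * (ε k r * ε k (∑ j ∈ Finset.range l, dg (j + 1))) by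
            ring]]
    abel
  · by_cases hi : i < p
    · simp only [intDiffSeq, coface, if_pos hi]
      congr 2
      refine sum_range_merge _ _ hi (fun l hl => ?_) ?_ fun l hl => ?_
      · rw [Finset.sum_congr rfl fun j hj => (mergeAt_of_lt (· + ·) dg
          ((Finset.mem_range.mp hj).trans hl)).symm]
        congr 1
        refine evalSeq_congr k f _ _ fun j _ => ?_
        simp only [mergeAt, Function.update_apply]
        grind
      · have hleft : evalSeq k f (mergeAt (· * ·) i (Function.update a i (R.d (a i))))
            (mergeAt (· + ·) i (Function.update dg i (dg i + 1))) =
            evalSeq k f (Function.update (mergeAt (· * ·) i a) i (R.d (a i) * a (i + 1)))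
              dg := by
          refine evalSeq_congr k f _ _ fun j _ => ?_
          simp only [mergeAt, Function.update_apply]
          grind
        have hright : evalSeq k f
            (mergeAt (· * ·) i (Function.update a (i + 1) (R.d (a (i + 1)))))
            (mergeAt (· + ·) i (Function.update dg (i + 1) (dg (i + 1) + 1))) =
            evalSeq k f (Function.update (mergeAt (· * ·) i a) i (a i * R.d (a (i + 1))))
              dg := by
          refine evalSeq_congr k f _ _ fun j _ => ?_
          simp only [mergeAt, Function.update_apply]
          grind
        rw [hleft, hright, evalSeq_update k f _ _ hi, evalSeq_update k f _ _ hi,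
          evalSeq_update k f _ _ hi, mergeAt_self, R.d_leibniz _ _ (ha i),
          MultilinearMap.map_update_add, MultilinearMap.map_update_smul,
          Finset.sum_range_succ, ε_add,
          Finset.sum_congr rfl fun j hj => mergeAt_of_lt (· + ·) dg (Finset.mem_range.mp hj)]
        module
      · rw [sum_range_mergeAt dg hl]
        congr 1
        refine evalSeq_congr k f _ _ fun j _ => ?_
        simp only [mergeAt, Function.update_apply]
        grind
    · have hmem : evalSeq k f a dg ∈ St.gr (∑ j ∈ Finset.range p, dg j + r) := by
        rw [Finset.sum_range]
        exact hf dg a ha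
      have hlast : evalSeq k f (Function.update a p (R.d (a p)))
          (Function.update dg p (dg p + 1)) = evalSeq k f a dg :=
        evalSeq_congr k f _ _ fun j hj => Function.update_of_ne hj.ne _ _
      have hfix : ∀ l ∈ Finset.range p, ε k (∑ j ∈ Finset.range l, dg j) •
          St.actR (Function.update a l (R.d (a l)) p)
            (evalSeq k f (Function.update a l (R.d (a l))) (Function.update dg l (dg l + 1))) =
          St.actR (a p) (ε k (∑ j ∈ Finset.range l, dg j) •
            evalSeq k f (Function.update a l (R.d (a l)))
              (Function.update dg l (dg l + 1))) := fun l hl => by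
        rw [Function.update_of_ne (Finset.mem_range.mp hl).ne', map_smul]
      simp only [intDiffSeq, coface, if_neg hi]
      rw [Finset.sum_range_succ, hlast, Function.update_self, St.dM_actR _ _ hmem, map_sub,
        map_smul, Finset.sum_congr rfl hfix, ← map_sum, ε_add]
      module

theorem intDiff_hochDiff {St : DGBimod k R M}
    {dHM : ∀ (p : ℕ) (r : ℤ), MCoch k A M p →ₗ[k] MCoch k A M (p + 1)}
    {pdM : ∀ (p : ℕ) (r : ℤ), MCoch k A M p →ₗ[k] MCoch k A M p}
    (hdHM : IsHochDiffM k St dHM) (hpdM : IsIntDiffM k St pdM) (p : ℕ) (r : ℤ)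
    {f : MCoch k A M p} (hf : IsHomogM k St p r f) :
    pdM (p + 1) r (dHM p r f) = -dHM p (r + 1) (pdM p r f) := by
  refine mcoch_ext_homogeneous k R fun dg a ha => ?_
  change evalSeq k (pdM (p + 1) r (dHM p r f)) a dg =
    -evalSeq k (dHM p (r + 1) (pdM p r f)) a dg
  rw [intDiff_apply k hpdM _ _ _ ha, hochDiff_apply k hdHM _ _ _ ha,
    intDiffSeq_congr k St _ _ (fun b dg' hb => hochDiff_apply k hdHM p r f hb) ha,
    intDiffSeq_smul, intDiffSeq_sum, ← neg_smul]
  congr 1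
  · simp only [ε_sub, ε_add, ε_one]
    ring
  · refine Finset.sum_congr rfl fun i _ => ?_
    rw [intDiffSeq_smul, intDiffSeq_coface k St p r hf ha,
      coface_congr k St _ _ _ (fun b dg' hb => intDiff_apply k hpdM p r f hb) ha]

/- Homogeneity -/

theorem isHomogM_hochDiff {St : DGBimod k R M}
    {dHM : ∀ (p : ℕ) (r : ℤ), MCoch k A M p →ₗ[k] MCoch k A M (p + 1)}
    (hdHM : IsHochDiffM k St dHM) {p : ℕ} {r : ℤ} {f : MCoch k A M p}
    (hf : IsHomogM k St p r f) : IsHomogM k St (p + 1) r (dHM p r f) := by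
  intro dg a ha
  change evalSeq k (dHM p r f) a dg ∈ _
  have hev : ∀ (b : ℕ → A) (dg' : ℕ → ℤ), (∀ i, b i ∈ R.gr (dg' i)) →
      evalSeq k f b dg' ∈ St.gr (∑ i ∈ Finset.range p, dg' i + r) := fun b dg' hb => by
    rw [Finset.sum_range]
    exact hf dg' b hb
  rw [hochDiff_apply k hdHM _ _ _ ha, ← Finset.sum_range dg]
  refine Submodule.smul_mem _ _ (Submodule.sum_mem _ fun i _ => Submodule.smul_mem _ _ ?_)
  rcases i with _ | i
  · refine Submodule.smul_mem _ _ ?_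
    have := St.actL_mem (ha 0) (hev _ _ fun j => ha (j + 1))
    rwa [← add_assoc, add_comm (dg 0), ← Finset.sum_range_succ'] at this
  · simp only [coface]
    split_ifs with hi
    · have := hev _ _ (mergeAt_mem k R ha i)
      rwa [sum_range_mergeAt dg hi] at this
    · have := St.actR_mem (ha p) (hev _ _ ha)
      rwa [add_right_comm, ← Finset.sum_range_succ] at this

theorem isHomogM_Hop {St : DGBimod k R M} {h : M →ₗ[k] M} (hh : IsContracting k St h)
    {p : ℕ} {r : ℤ} {f : MCoch k A M p} (hf : IsHomogM k St p r f) :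
    IsHomogM k St p (r - 1) (Hop k h f) := by
  intro dg a ha
  rw [← add_sub_assoc]
  exact hh.2 (hf dg a ha)

theorem isHomogM_frakh {St : DGBimod k R M}
    {dHM : ∀ (p : ℕ) (r : ℤ), MCoch k A M p →ₗ[k] MCoch k A M (p + 1)}
    (hdHM : IsHochDiffM k St dHM) {h : M →ₗ[k] M} (hh : IsContracting k St h)
    {p : ℕ} {r : ℤ} {f : MCoch k A M p} (hf : IsHomogM k St p r f) (j : ℕ) :
    IsHomogM k St (p + j) (r - j - 1) (frakh k dHM h p r j f) := by
  induction j with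
  | zero =>
    rw [Nat.cast_zero, sub_zero]
    exact isHomogM_Hop k hh hf
  | succ j ih =>
    have := isHomogM_Hop k hh (isHomogM_hochDiff k hdHM ih)
    rw [Nat.cast_succ, ← sub_sub r]
    exact this

/- The homotopy -/

theorem Hop_intDiff_add {St : DGBimod k R M} {h : M →ₗ[k] M} (hh : IsContracting k St h)
    {pdM : ∀ (p : ℕ) (r : ℤ), MCoch k A M p →ₗ[k] MCoch k A M p}
    (hpdM : IsIntDiffM k St pdM) (p : ℕ) (r : ℤ) (f : MCoch k A M p) :
    Hop k h (pdM p r f) + pdM p (r - 1) (Hop k h f) = f := by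
  refine mcoch_ext_homogeneous k R fun dg a ha => ?_
  have hHop : evalSeq k (Hop k h f) = fun b dg' => h (evalSeq k f b dg') := rfl
  change h (evalSeq k (pdM p r f) a dg) + evalSeq k (pdM p (r - 1) (Hop k h f)) a dg =
    evalSeq k f a dg
  rw [intDiff_apply k hpdM _ _ _ ha, intDiff_apply k hpdM _ _ _ ha, hHop]
  simp only [intDiffSeq, map_sub, map_smul, map_sum, ε_sub, ε_one]
  refine Eq.trans ?_ (hh.1 (evalSeq k f a dg))
  module

theorem Hop_add (h : M →ₗ[k] M) {p : ℕ} (f g : MCoch k A M p) :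
    Hop k h (f + g) = Hop k h f + Hop k h g := by
  ext a
  exact map_add h _ _

theorem Hop_neg (h : M →ₗ[k] M) {p : ℕ} (f : MCoch k A M p) :
    Hop k h (-f) = -Hop k h f := by
  ext a
  exact map_neg h _

theorem mcochCast_Hop_hochDiff
    (dHM : ∀ (p : ℕ) (r : ℤ), MCoch k A M p →ₗ[k] MCoch k A M (p + 1)) (h : M →ₗ[k] M)
    {p q : ℕ} (hpq : p = q) (r : ℤ) (f : MCoch k A M p) :
    mcochCast k (congrArg (· + 1) hpq) (Hop k h (dHM p r f)) =
      Hop k h (dHM q r (mcochCast k hpq f)) := by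
  subst hpq
  rfl

/-- `∂ H d_H = d_H + H d_H ∂` on homogeneous cochains. -/
theorem intDiff_Hop_hochDiff {St : DGBimod k R M} {h : M →ₗ[k] M} (hh : IsContracting k St h)
    {dHM : ∀ (p : ℕ) (r : ℤ), MCoch k A M p →ₗ[k] MCoch k A M (p + 1)}
    {pdM : ∀ (p : ℕ) (r : ℤ), MCoch k A M p →ₗ[k] MCoch k A M p}
    (hdHM : IsHochDiffM k St dHM) (hpdM : IsIntDiffM k St pdM) (p : ℕ) (r : ℤ)
    {f : MCoch k A M p} (hf : IsHomogM k St p r f) :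
    pdM (p + 1) (r - 1) (Hop k h (dHM p r f)) =
      dHM p r f + Hop k h (dHM p (r + 1) (pdM p r f)) := by
  have key := Hop_intDiff_add k hh hpdM (p + 1) r (dHM p r f)
  rw [intDiff_hochDiff k hdHM hpdM p r hf, Hop_neg, neg_add_eq_iff_eq_add] at key
  exact key.trans (add_comm _ _)

theorem intDiff_frakh_succ {St : DGBimod k R M} {h : M →ₗ[k] M} (hh : IsContracting k St h)
    {dHM : ∀ (p : ℕ) (r : ℤ), MCoch k A M p →ₗ[k] MCoch k A M (p + 1)}
    {pdM : ∀ (p : ℕ) (r : ℤ), MCoch k A M p →ₗ[k] MCoch k A M p}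
    (hdHM : IsHochDiffM k St dHM) (hpdM : IsIntDiffM k St pdM) (p : ℕ) (r : ℤ)
    {f : MCoch k A M p} (hf : IsHomogM k St p r f) (j : ℕ) :
    pdM (p + (j + 1)) (r - (j + 1) - 1) (frakh k dHM h p r (j + 1) f)
      + frakh k dHM h p (r + 1) (j + 1) (pdM p r f)
      = dHM (p + j) (r - j - 1) (frakh k dHM h p r j f)
      + mcochCast k (Nat.succ_add_eq_add_succ p j) (frakh k dHM h (p + 1) r j (dHM p r f)) := by
  have hreduce : ∀ j : ℕ,
      pdM (p + (j + 1)) (r - (j + 1) - 1) (frakh k dHM h p r (j + 1) f)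
        + frakh k dHM h p (r + 1) (j + 1) (pdM p r f)
        = dHM (p + j) (r - j - 1) (frakh k dHM h p r j f)
        + Hop k h (dHM (p + j) (r - j) (pdM (p + j) (r - j - 1) (frakh k dHM h p r j f)
          + frakh k dHM h p (r + 1) j (pdM p r f))) := by
    intro j
    have hstep := intDiff_Hop_hochDiff k hh hdHM hpdM (p + j) (r - j - 1)
      (isHomogM_frakh k hdHM hh hf j)
    have hlast : frakh k dHM h p (r + 1) (j + 1) (pdM p r f) =
        Hop k h (dHM (p + j) (r - j) (frakh k dHM h p (r + 1) j (pdM p r f))) := by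
      rw [show r - (j : ℤ) = r + 1 - j - 1 by ring]
      rfl
    rw [sub_add_cancel] at hstep
    rw [hlast, map_add, Hop_add, sub_add_eq_sub_sub]
    exact (congrArg (· + _) hstep).trans (add_assoc _ _ _)
  induction j with
  | zero =>
    rw [hreduce]
    congr 1
    have hzero := Hop_intDiff_add k hh hpdM p r f
    rw [add_comm] at hzero
    simp only [Nat.cast_zero, sub_zero]
    exact congrArg (fun g => Hop k h (dHM p r g)) hzero
  | succ j ih =>
    rw [hreduce]
    congr 1
    have hcast := mcochCast_Hop_hochDiff k dHM h (Nat.succ_add_eq_add_succ p j)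
      (r - j - 1) (frakh k dHM h (p + 1) r j (dHM p r f))
    refine Eq.trans ?_ hcast.symm
    rw [Nat.cast_succ, ih, map_add, sub_add_eq_sub_sub]
    have hsq := hochDiff_hochDiff k hdHM (p + j) (r - j - 1) (frakh k dHM h p r j f)
    refine congrArg (Hop k h) ?_
    exact (congrArg (· + _) hsq).trans (zero_add _)

/-- With `(A, d_A)` a dg algebra over a field of characteristic
zero and `(M, d_M)` an acyclic dg `A`-`A`-bimodule with contracting homotopy
`h`, let `H := h ∘ (−)` and `𝔥_j := (H ∘ d_H)^j ∘ H`.  Then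
`𝔥 := Σ_j (-1)^j 𝔥_j : Hoch_⊕^•(A,M) → Hoch_∏^{•-1}(A,M)` satisfies
`𝔥∘(∂ + d_H) + (∂ + d_H)∘𝔥 = id` (stated componentwise in the product-total
complex), and in particular `∂∘𝔥_{j+1} + 𝔥_{j+1}∘∂ = d_H∘𝔥_j + 𝔥_j∘d_H` for
all `j ≥ 0`. -/
theorem statement5
    (k : Type) [Field k] [CharZero k]
    (A : Type) [Ring A] [Algebra k A]
    (M : Type) [AddCommGroup M] [Module k M]
    (R : KD.DGAlgebra k A) (St : KD.DGBimod k R M)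
    (hacyclic : ∀ m : M, St.dM m = 0 → ∃ m' : M, m = St.dM m')
    (h : M →ₗ[k] M) (hh : KD.IsContracting k St h)
    (dHM : ∀ (p : ℕ) (r : ℤ), KD.MCoch k A M p →ₗ[k] KD.MCoch k A M (p + 1))
    (pdM : ∀ (p : ℕ) (r : ℤ), KD.MCoch k A M p →ₗ[k] KD.MCoch k A M p)
    (hdHM : KD.IsHochDiffM k St dHM) (hpdM : KD.IsIntDiffM k St pdM) :
    ∀ (p : ℕ) (r : ℤ) (f : KD.MCoch k A M p), KD.IsHomogM k St p r f →
      -- the homotopy identity `𝔥 (∂ + d_H) + (∂ + d_H) 𝔥 = id`, componentwise: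
      -- arity `p` component:
      (KD.Hop k h (pdM p r f) + pdM p (r - 1) (KD.Hop k h f) = f)
      -- arity `p + j + 1` components (each vanishes):
      ∧ (∀ j : ℕ,
          pdM (p + (j + 1)) (r - (j + 1) - 1) (KD.frakh k dHM h p r (j + 1) f)
          + KD.frakh k dHM h p (r + 1) (j + 1) (pdM p r f)
          = dHM (p + j) (r - j - 1) (KD.frakh k dHM h p r j f)
          + KD.mcochCast k (by omega) (KD.frakh k dHM h (p + 1) r j (dHM p r f))) := by
  intro p r f hf
  exact ⟨Hop_intDiff_add k hh hpdM p r f, intDiff_frakh_succ k hh hdHM hpdM p r hf⟩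
end KD
end
end
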